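/- arXiv:2412.01392 — 2 statements merged into one kernel-verified Lean document; each statement's English description precedes it below -/
import Mathlib

section
/- Let R be a Noetherian local ring. Then G(R)^⊥ ∩ G̃(R) = P̃(R), i.e., a finitely generated R-module X of finite Gorenstein dimension satisfies Ext^i_R(G,X) = 0 for all totally reflexive modules G and all i > 0 if and only if X has finite projective dimension. -/
open CategoryTheory

noncomputable section

universe u

variable (R : Type u) [CommRing R]

/-- The `i`-th Ext module of two `R`-modules. -/
abbrev ExtMod (i : ℕ) (M N : ModuleCat.{u} R) : ModuleCat.{u} R :=
  ((Ext R (ModuleCat.{u} R) i).obj (Opposite.op M)).obj N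

/-- The `i`-th Tor module of two `R`-modules. -/
abbrev TorMod (i : ℕ) (M N : ModuleCat.{u} R) : ModuleCat.{u} R :=
  ((Tor' (ModuleCat.{u} R) i).obj M).obj N

/-- `D^⊥`. -/
def perpSet (D : Set (ModuleCat.{u} R)) : Set (ModuleCat.{u} R) :=
  {Y | ∀ X ∈ D, ∀ i : ℕ, 0 < i → Subsingleton (ExtMod R i X Y)}

/-- `E^⊤`. -/
def topSet (E : Set (ModuleCat.{u} R)) : Set (ModuleCat.{u} R) :=
  {X | ∀ Y ∈ E, ∀ i : ℕ, 0 < i → Subsingleton (ExtMod R i X Y)}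

/-- depth via maximal lengths of regular sequences in the maximal ideal. -/
def depth [IsLocalRing R] (M : ModuleCat.{u} R) : ℕ :=
  sSup {n | ∃ rs : List R, rs.length = n ∧ (∀ r ∈ rs, r ∈ IsLocalRing.maximalIdeal R) ∧
    RingTheory.Sequence.IsRegular M rs}

/-- `pd_R M ≤ n` via free syzygies. -/
def ProjDimLE : ℕ → ModuleCat.{u} R → Prop
  | 0, M => Projective M
  | n+1, M => ∃ (K F : ModuleCat.{u} R) (f : K ⟶ F) (g : F ⟶ M) (w : f ≫ g = 0),
      Module.Free R F ∧ (ShortComplex.mk f g w).ShortExact ∧ ProjDimLE n K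

/-- Projective dimension, in `ℕ∞`. -/
def projDim (M : ModuleCat.{u} R) : ℕ∞ :=
  sInf {d : ℕ∞ | ∃ n : ℕ, d = n ∧ ProjDimLE R n M}

/-- Totally reflexive modules. -/
def TotallyReflexive (M : ModuleCat.{u} R) : Prop :=
  Function.Bijective (Module.Dual.eval R M) ∧
  (∀ i : ℕ, 0 < i → Subsingleton (ExtMod R i M (ModuleCat.of R R))) ∧
  (∀ i : ℕ, 0 < i → Subsingleton (ExtMod R i (ModuleCat.of R (Module.Dual R M)) (ModuleCat.of R R)))

/-- `G-dim_R M ≤ n` via syzygies. -/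
def GdimLE : ℕ → ModuleCat.{u} R → Prop
  | 0, M => TotallyReflexive R M
  | n+1, M => ∃ (K F : ModuleCat.{u} R) (f : K ⟶ F) (g : F ⟶ M) (w : f ≫ g = 0),
      Module.Free R F ∧ (ShortComplex.mk f g w).ShortExact ∧ GdimLE n K

/-- Gorenstein dimension, in `ℕ∞`. -/
def Gdim (M : ModuleCat.{u} R) : ℕ∞ :=
  sInf {d : ℕ∞ | ∃ n : ℕ, d = n ∧ GdimLE R n M}

/-- `M` is an `n`-th syzygy module. -/
def IsNthSyzygy : ℕ → ModuleCat.{u} R → Prop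
  | 0, _ => True
  | n+1, M => ∃ (F C : ModuleCat.{u} R) (f : M ⟶ F) (g : F ⟶ C) (w : f ≫ g = 0),
      Module.Free R F ∧ (ShortComplex.mk f g w).ShortExact ∧ IsNthSyzygy n C

/-- `syz_R M`: the largest `t ≤ depth R` such that `M` is a `t`-th syzygy. -/
def syz [IsLocalRing R] (M : ModuleCat.{u} R) : ℕ :=
  sSup {t | t ≤ depth R (ModuleCat.of R R) ∧ IsNthSyzygy R t M}

/-- Complexity of a sequence of natural numbers. -/
def seqComplexity (b : ℕ → ℕ) : ℕ :=
  sInf {r : ℕ | ∃ α : ℝ, ∀ᶠ n in Filter.atTop, (b n : ℝ) ≤ α * (n : ℝ) ^ ((r : ℝ) - 1)}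

/-- Minimal number of generators. -/
def numGen (M : ModuleCat.{u} R) : ℕ :=
  sInf {n | ∃ s : Finset M, s.card = n ∧ Submodule.span R (s : Set M) = ⊤}

/-- Complexity of a pair of modules. -/
def cx (M N : ModuleCat.{u} R) : ℕ :=
  seqComplexity (fun i => numGen R (ExtMod R i M N))

/-- Regular local ring: Noetherian local, maximal ideal generated by a regular sequence. -/
def IsRegularLocal (Q : Type u) [CommRing Q] : Prop :=
  IsLocalRing Q ∧ IsNoetherianRing Q ∧
  ∃ rs : List Q, RingTheory.Sequence.IsRegular Q rs ∧ (Ideal.span {x | x ∈ rs}).IsMaximal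

/-- Local complete intersection ring: the completion is a regular local ring
modulo a regular sequence. -/
def IsCompleteIntersectionLocal (R : Type u) [CommRing R] [IsLocalRing R] : Prop :=
  ∃ (Q : CommRingCat.{u})
    (φ : ↥Q →+* AdicCompletion (IsLocalRing.maximalIdeal R) R),
    IsRegularLocal ↥Q ∧ Function.Surjective φ ∧
    ∃ rs : List ↥Q, RingTheory.Sequence.IsRegular (↥Q) rs ∧
      RingHom.ker φ = Ideal.span {x | x ∈ rs}

/-- Gorenstein local ring: `R` has finite injective dimension over itself,
expressed via eventual vanishing of `Ext^i(-, R)`. -/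
def IsGorensteinLocal (R : Type u) [CommRing R] : Prop :=
  IsLocalRing R ∧ IsNoetherianRing R ∧
  ∃ n : ℕ, ∀ (M : ModuleCat.{u} R) (i : ℕ), n < i → Subsingleton (ExtMod R i M (ModuleCat.of R R))



section ExtVanishing

variable {R}
variable {M N A B C : Type u} [AddCommGroup M] [Module R M] [AddCommGroup N] [Module R N]
  [AddCommGroup A] [Module R A] [AddCommGroup B] [Module R B] [AddCommGroup C] [Module R C]

/-- The two constructions of `Ext` in Mathlib vanish simultaneously in positive degrees. -/
theorem subsingleton_extMod_succ_iff (M N : ModuleCat.{u} R) (n : ℕ) :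
    Subsingleton (ExtMod R (n + 1) M N) ↔ Subsingleton (Abelian.Ext M N (n + 1)) := by
  let P := ProjectiveResolution.of M
  have key : Subsingleton (Abelian.Ext M N (n + 1)) ↔
      ∀ f : P.complex.X (n + 1) ⟶ N, P.complex.d (n + 2) (n + 1) ≫ f = 0 →
        ∃ g : P.complex.X n ⟶ N, P.complex.d (n + 1) n ≫ g = f := by
    constructor
    · intro h f hf
      exact (P.extMk_eq_zero_iff f (n + 2) rfl hf n rfl).1 (Subsingleton.elim _ _)
    · intro h
      refine subsingleton_of_forall_eq 0 fun α => ?_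
      obtain ⟨f, hf, rfl⟩ := P.extMk_surjective α (n + 2) rfl
      exact (P.extMk_eq_zero_iff f (n + 2) rfl hf n rfl).2 (h f hf)
  rw [key, ← ModuleCat.isZero_iff_subsingleton, (P.isoExt (R := R) (n + 1) N).isZero_iff,
    ← HomologicalComplex.exactAt_iff_isZero_homology,
    HomologicalComplex.exactAt_iff' _ n (n + 1) (n + 2) (by simp) (by simp),
    ShortComplex.moduleCat_exact_iff]
  rfl

variable (R M N) in
/-- All the modules `Ext^i(M, N)` with `i > 0` vanish. -/
def ExtVanish : Prop :=
  ∀ n : ℕ, Subsingleton (Abelian.Ext (ModuleCat.of R M) (ModuleCat.of R N) (n + 1))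

theorem extVanish_iff (M N : ModuleCat.{u} R) :
    ExtVanish R M N ↔ ∀ i : ℕ, 0 < i → Subsingleton (ExtMod R i M N) := by
  refine ⟨fun h i hi => ?_, fun h n => (subsingleton_extMod_succ_iff M N n).1 (h _ n.succ_pos)⟩
  obtain ⟨n, rfl⟩ := Nat.exists_eq_succ_of_ne_zero hi.ne'
  exact (subsingleton_extMod_succ_iff M N n).2 (h n)

theorem shortExact_of_linearMap {f : A →ₗ[R] B} {g : B →ₗ[R] C} (hf : Function.Injective f)
    (hg : Function.Surjective g) (hfg : Function.Exact f g) :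
    (ShortComplex.mk (ModuleCat.ofHom f) (ModuleCat.ofHom g)
      (by rw [← ModuleCat.ofHom_comp, hfg.linearMap_comp_eq_zero]; rfl)).ShortExact where
  exact := (ShortComplex.ShortExact.moduleCat_exact_iff_function_exact _).mpr hfg
  mono_f := (ModuleCat.mono_iff_injective _).mpr hf
  epi_g := (ModuleCat.epi_iff_surjective _).mpr hg

namespace ExtVanish

theorem of_projective [Module.Projective R M] : ExtVanish R M N := fun n =>
  have : Projective (ModuleCat.of R M) := (IsProjective.iff_projective M).1 inferInstance
  Abelian.Ext.subsingleton_of_projective _ _ n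

theorem of_retract_left (h : ExtVanish R A N) (i : M →ₗ[R] A) (s : A →ₗ[R] M)
    (hs : s ∘ₗ i = .id) : ExtVanish R M N := fun n => by
  refine subsingleton_of_forall_eq 0 fun α => ?_
  have e : α = (Abelian.Ext.mk₀ (ModuleCat.ofHom i)).comp
      ((Abelian.Ext.mk₀ (ModuleCat.ofHom s)).comp α (zero_add _)) (zero_add _) := by
    rw [Abelian.Ext.mk₀_comp_mk₀_assoc, ← ModuleCat.ofHom_comp, hs, ModuleCat.ofHom_id,
      Abelian.Ext.mk₀_id_comp]
  have := h n
  rw [e, Subsingleton.elim ((Abelian.Ext.mk₀ (ModuleCat.ofHom s)).comp α (zero_add _)) 0,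
    Abelian.Ext.comp_zero]

theorem of_retract_right (h : ExtVanish R M A) (i : N →ₗ[R] A) (s : A →ₗ[R] N)
    (hs : s ∘ₗ i = .id) : ExtVanish R M N := fun n => by
  refine subsingleton_of_forall_eq 0 fun α => ?_
  have e : α = (α.comp (Abelian.Ext.mk₀ (ModuleCat.ofHom i)) (add_zero _)).comp
      (Abelian.Ext.mk₀ (ModuleCat.ofHom s)) (add_zero _) := by
    rw [Abelian.Ext.comp_assoc_of_second_deg_zero, Abelian.Ext.mk₀_comp_mk₀,
      ← ModuleCat.ofHom_comp, hs, ModuleCat.ofHom_id, Abelian.Ext.comp_mk₀_id]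
  have := h n
  rw [e, Subsingleton.elim (α.comp (Abelian.Ext.mk₀ (ModuleCat.ofHom i)) (add_zero _)) 0,
    Abelian.Ext.zero_comp]

theorem pi {ι : Type} [Fintype ι] (h : ExtVanish R M N) : ExtVanish R M (ι → N) := fun n => by
  classical
  refine subsingleton_of_forall_eq 0 fun α => ?_
  have e : ∑ i, ModuleCat.ofHom (LinearMap.proj (R := R) (φ := fun _ : ι => N) i) ≫
      ModuleCat.ofHom (LinearMap.single R (fun _ : ι => N) i) = 𝟙 (ModuleCat.of R (ι → N)) := by
    ext x j
    simp [ModuleCat.hom_sum, Finset.sum_apply, Pi.single_apply]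
  have := h n
  rw [← Abelian.Ext.comp_mk₀_id α, ← e, Abelian.Ext.mk₀_sum, Abelian.Ext.comp_sum]
  refine Finset.sum_eq_zero fun i _ => ?_
  rw [← Abelian.Ext.mk₀_comp_mk₀, ← Abelian.Ext.comp_assoc_of_second_deg_zero,
    Subsingleton.elim (α.comp (Abelian.Ext.mk₀ _) _) 0, Abelian.Ext.zero_comp]

variable {f : A →ₗ[R] B} {g : B →ₗ[R] C}

theorem left_of_shortExact (hf : Function.Injective f) (hg : Function.Surjective g)
    (hfg : Function.Exact f g) (hB : ExtVanish R B N) (hC : ExtVanish R C N) : ExtVanish R A N :=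
  fun n => by
  have hS := shortExact_of_linearMap hf hg hfg
  refine subsingleton_of_forall_eq 0 fun α => ?_
  have := hC (n + 1)
  have := hB n
  obtain ⟨β, rfl⟩ := Abelian.Ext.contravariant_sequence_exact₁ hS _ α (add_comm 1 (n + 1))
    (Subsingleton.elim _ _)
  rw [Subsingleton.elim β 0, Abelian.Ext.comp_zero]

theorem middle_of_shortExact (hf : Function.Injective f) (hg : Function.Surjective g)
    (hfg : Function.Exact f g) (hA : ExtVanish R A N) (hC : ExtVanish R C N) : ExtVanish R B N :=
  fun n => by
  have hS := shortExact_of_linearMap hf hg hfg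
  refine subsingleton_of_forall_eq 0 fun α => ?_
  have := hC n
  have := hA n
  obtain ⟨β, rfl⟩ := Abelian.Ext.contravariant_sequence_exact₂ hS _ α (Subsingleton.elim _ _)
  rw [Subsingleton.elim β 0, Abelian.Ext.comp_zero]

theorem right_of_shortExact (hf : Function.Injective f) (hg : Function.Surjective g)
    (hfg : Function.Exact f g) (hA : ExtVanish R A N) (hB : ExtVanish R B N)
    (hext : ∀ φ : A →ₗ[R] N, ∃ ψ : B →ₗ[R] N, ψ ∘ₗ f = φ) : ExtVanish R C N := fun n => by
  have hS := shortExact_of_linearMap hf hg hfg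
  refine subsingleton_of_forall_eq 0 fun α => ?_
  have := hB n
  obtain ⟨β, rfl⟩ := Abelian.Ext.contravariant_sequence_exact₃ hS _ α (Subsingleton.elim _ _)
    (add_comm 1 n)
  cases n with
  | zero =>
    obtain ⟨φ, rfl⟩ := Abelian.Ext.addEquiv₀.symm.surjective β
    obtain ⟨ψ, hψ⟩ := hext φ.hom
    have e : φ = ModuleCat.ofHom f ≫ ModuleCat.ofHom ψ := ModuleCat.hom_ext hψ.symm
    rw [e, Abelian.Ext.addEquiv₀_symm_apply, ← Abelian.Ext.mk₀_comp_mk₀,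
      ← Abelian.Ext.comp_assoc_of_third_deg_zero]
    erw [hS.extClass_comp]
    rw [Abelian.Ext.zero_comp]
  | succ n =>
    have := hA n
    rw [Subsingleton.elim β 0, Abelian.Ext.comp_zero]

theorem exists_extension (hf : Function.Injective f) (hg : Function.Surjective g)
    (hfg : Function.Exact f g) (hC : ExtVanish R C N) (φ : A →ₗ[R] N) :
    ∃ ψ : B →ₗ[R] N, ψ ∘ₗ f = φ := by
  have hS := shortExact_of_linearMap hf hg hfg
  have := hC 0
  obtain ⟨β, hβ⟩ := Abelian.Ext.contravariant_sequence_exact₁ hS (ModuleCat.of R N)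
    (Abelian.Ext.mk₀ (ModuleCat.ofHom φ)) (add_zero 1) (Subsingleton.elim _ _)
  obtain ⟨ψ, rfl⟩ := (Abelian.Ext.mk₀_bijective _ _).2 β
  rw [Abelian.Ext.mk₀_comp_mk₀] at hβ
  refine ⟨ψ.hom, ?_⟩
  exact congr_arg ModuleCat.Hom.hom ((Abelian.Ext.mk₀_bijective _ _).1 hβ)

theorem of_shortExact_right (hf : Function.Injective f) (hg : Function.Surjective g)
    (hfg : Function.Exact f g) (hA : ExtVanish R M A) (hB : ExtVanish R M B) : ExtVanish R M C :=
  fun n => by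
  have hS := shortExact_of_linearMap hf hg hfg
  refine subsingleton_of_forall_eq 0 fun α => ?_
  have := hA (n + 1)
  have := hB n
  obtain ⟨β, rfl⟩ := Abelian.Ext.covariant_sequence_exact₃ _ hS α rfl (Subsingleton.elim _ _)
  rw [Subsingleton.elim β 0, Abelian.Ext.zero_comp]

theorem subsingleton_ext_left (hf : Function.Injective f) (hg : Function.Surjective g)
    (hfg : Function.Exact f g) (hB : ExtVanish R M B) (hC : ExtVanish R M C) (n : ℕ) :
    Subsingleton (Abelian.Ext (ModuleCat.of R M) (ModuleCat.of R A) (n + 2)) := by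
  have hS := shortExact_of_linearMap hf hg hfg
  refine subsingleton_of_forall_eq 0 fun α => ?_
  have := hB (n + 1)
  have := hC n
  obtain ⟨β, rfl⟩ := Abelian.Ext.covariant_sequence_exact₁ _ hS α (Subsingleton.elim _ _) rfl
  rw [Subsingleton.elim β 0, Abelian.Ext.zero_comp]

theorem subsingleton_ext_of_projective_middle [Module.Projective R B]
    (hf : Function.Injective f) (hg : Function.Surjective g) (hfg : Function.Exact f g) (n : ℕ)
    (h : Subsingleton (Abelian.Ext (ModuleCat.of R C) (ModuleCat.of R N) (n + 2))) :
    Subsingleton (Abelian.Ext (ModuleCat.of R A) (ModuleCat.of R N) (n + 1)) := by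
  have hS := shortExact_of_linearMap hf hg hfg
  refine subsingleton_of_forall_eq 0 fun α => ?_
  have := of_projective (R := R) (M := B) (N := N) n
  obtain ⟨β, rfl⟩ := Abelian.Ext.contravariant_sequence_exact₁ hS _ α (add_comm 1 (n + 1))
    (Subsingleton.elim _ _)
  rw [Subsingleton.elim β 0, Abelian.Ext.comp_zero]

end ExtVanish

end ExtVanishing

section TotallyReflexiveModules

open Module Function

variable {R}
variable {M N A B C : Type u} [AddCommGroup M] [Module R M] [AddCommGroup N] [Module R N]
  [AddCommGroup A] [Module R A] [AddCommGroup B] [Module R B] [AddCommGroup C] [Module R C]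
  {f : A →ₗ[R] B} {g : B →ₗ[R] C}

theorem dualMap_exact (hg : Surjective g) (hfg : Exact f g) : Exact g.dualMap f.dualMap :=
  LinearMap.exact_lcomp_of_exact_of_surjective R hfg hg

theorem ExtVanish.dualMap_surjective (hC : ExtVanish R C R) (hf : Injective f)
    (hg : Surjective g) (hfg : Exact f g) : Surjective f.dualMap :=
  fun φ => hC.exists_extension hf hg hfg φ

theorem totallyReflexive_iff (M : ModuleCat.{u} R) :
    TotallyReflexive R M ↔
      IsReflexive R M ∧ ExtVanish R M R ∧ ExtVanish R (Dual R M) R := by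
  rw [TotallyReflexive, ← extVanish_iff, ← extVanish_iff]
  exact and_congr_left' ⟨fun h => ⟨h⟩, fun h => h.bijective_dual_eval'⟩

namespace TotallyReflexive

theorem of_retract (h : TotallyReflexive R (.of R A)) (i : M →ₗ[R] A) (s : A →ₗ[R] M)
    (hs : s ∘ₗ i = .id) : TotallyReflexive R (.of R M) := by
  obtain ⟨_, h₁, h₂⟩ := (totallyReflexive_iff _).1 h
  have : IsReflexive R A := ‹_›
  exact (totallyReflexive_iff _).2 ⟨IsReflexive.of_split i s hs, h₁.of_retract_left i s hs,
    h₂.of_retract_left s.dualMap i.dualMap (congr_arg LinearMap.dualMap hs)⟩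

theorem of_finite_projective [Module.Finite R M] [Projective R M] :
    TotallyReflexive R (.of R M) :=
  (totallyReflexive_iff _).2 ⟨inferInstanceAs (IsReflexive R M), ExtVanish.of_projective,
    ExtVanish.of_projective (M := Dual R M)⟩

theorem dual (h : TotallyReflexive R (.of R M)) : TotallyReflexive R (.of R (Dual R M)) := by
  obtain ⟨_, h₁, h₂⟩ := (totallyReflexive_iff _).1 h
  have : IsReflexive R M := ‹_›
  exact (totallyReflexive_iff _).2 ⟨inferInstanceAs (IsReflexive R (Dual R M)), h₂,
    h₁.of_retract_left (evalEquiv R M).symm.toLinearMap (evalEquiv R M).toLinearMap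
      (LinearMap.ext (evalEquiv R M).apply_symm_apply)⟩

theorem prod (hM : TotallyReflexive R (.of R M)) (hN : TotallyReflexive R (.of R N)) :
    TotallyReflexive R (.of R (M × N)) := by
  obtain ⟨_, h₁, h₂⟩ := (totallyReflexive_iff _).1 hM
  obtain ⟨_, h₃, h₄⟩ := (totallyReflexive_iff _).1 hN
  have : IsReflexive R M := ‹_›
  have : IsReflexive R N := ‹_›
  refine (totallyReflexive_iff _).2 ⟨inferInstanceAs (IsReflexive R (M × N)), ?_, ?_⟩
  · exact ExtVanish.middle_of_shortExact LinearMap.inl_injective LinearMap.snd_surjective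
      Exact.inl_snd h₁ h₃
  · exact ExtVanish.middle_of_shortExact
      (LinearMap.dualMap_injective_of_surjective LinearMap.snd_surjective)
      (h₃.dualMap_surjective LinearMap.inl_injective LinearMap.snd_surjective Exact.inl_snd)
      (dualMap_exact LinearMap.snd_surjective Exact.inl_snd) h₄ h₂

/-- The kernel of a surjection between totally reflexive modules is totally reflexive. -/
theorem left_of_shortExact (hB : TotallyReflexive R (.of R B)) (hC : TotallyReflexive R (.of R C))
    (hf : Injective f) (hg : Surjective g) (hfg : Exact f g) :
    TotallyReflexive R (.of R A) := by
  obtain ⟨_, h₁, h₂⟩ := (totallyReflexive_iff _).1 hB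
  obtain ⟨_, h₃, h₄⟩ := (totallyReflexive_iff _).1 hC
  have : IsReflexive R B := ‹_›
  have : IsReflexive R C := ‹_›
  have hinj := LinearMap.dualMap_injective_of_surjective hg
  have hsurj := ExtVanish.dualMap_surjective h₃ hf hg hfg
  have hexact := dualMap_exact hg hfg
  refine (totallyReflexive_iff _).2 ⟨⟨?_⟩, ?_, ?_⟩
  · exact LinearMap.bijective_of_bijective_of_injective_of_left_exact f g f.dualMap.dualMap
      g.dualMap.dualMap (Dual.eval R A) (Dual.eval R B) (Dual.eval R C)
      (Dual.eval_naturality f) (Dual.eval_naturality g) hfg (dualMap_exact hsurj hexact)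
      (bijective_dual_eval R B) (bijective_dual_eval R C).1 hf
      (LinearMap.dualMap_injective_of_surjective hsurj)
  · exact ExtVanish.left_of_shortExact hf hg hfg h₁ h₃
  · refine ExtVanish.right_of_shortExact hinj hsurj hexact h₄ h₂ fun φ => ?_
    obtain ⟨c, rfl⟩ := (bijective_dual_eval R C).2 φ
    obtain ⟨b, rfl⟩ := hg c
    exact ⟨Dual.eval R B b, rfl⟩

/-- A finitely generated totally reflexive module embeds into a finitely generated projective
module with totally reflexive cokernel. -/
theorem exists_embedding [IsNoetherianRing R] [Module.Finite R M]
    (h : TotallyReflexive R (.of R M)) :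
    ∃ (F G : ModuleCat.{u} R) (f : M →ₗ[R] F) (g : F →ₗ[R] G), Module.Finite R F ∧
      Projective R F ∧ TotallyReflexive R G ∧ Injective f ∧ Surjective g ∧ Exact f g := by
  obtain ⟨_, -, h₂⟩ := (totallyReflexive_iff _).1 h
  have : IsReflexive R M := ‹_›
  obtain ⟨m, p, hp⟩ := Module.Finite.exists_fin' R (Dual R M)
  have hker := p.exact_subtype_ker_map
  have hsub := (LinearMap.ker p).injective_subtype
  have hL := (left_of_shortExact of_finite_projective h.dual hsub hp hker).dual
  refine ⟨.of R (Dual R (Fin m → R)), .of R (Dual R (LinearMap.ker p)),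
    p.dualMap ∘ₗ Dual.eval R M, (LinearMap.ker p).subtype.dualMap,
    inferInstanceAs (Module.Finite R (Dual R (Fin m → R))),
    inferInstanceAs (Projective R (Dual R (Fin m → R))), hL, ?_, ?_, ?_⟩
  · exact (LinearMap.dualMap_injective_of_surjective hp).comp (bijective_dual_eval R M).1
  · exact ExtVanish.dualMap_surjective h₂ hsub hp hker
  · intro y
    rw [dualMap_exact hp hker y, LinearMap.coe_comp, (bijective_dual_eval R M).2.range_comp]

end TotallyReflexive

theorem Function.Exact.nonempty_equiv_prod [Projective R C] (hf : Injective f)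
    (hg : Surjective g) (hfg : Exact f g) : Nonempty (B ≃ₗ[R] A × C) := by
  obtain ⟨s, hs⟩ := g.exists_rightInverse_of_surjective (LinearMap.range_eq_top.2 hg)
  exact ⟨(hfg.splitSurjectiveEquiv hf ⟨s, hs⟩).1⟩

theorem GdimLE.of_equiv_prod [Module.Finite R B] [Module.Free R B] {n : ℕ}
    (hA : GdimLE R n (.of R A)) (e : C ≃ₗ[R] A × B) : GdimLE R n (.of R C) := by
  cases n with
  | zero =>
    have h : TotallyReflexive R (.of R (A × B)) := TotallyReflexive.prod hA .of_finite_projective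
    exact h.of_retract e.toLinearMap e.symm.toLinearMap (by simp)
  | succ n =>
    obtain ⟨K, F, f, g, w, hF, hS, hK⟩ := hA
    have hfg := (ShortComplex.ShortExact.moduleCat_exact_iff_function_exact _).1 hS.exact
    have hf := hS.moduleCat_injective_f
    have hg := hS.moduleCat_surjective_g
    dsimp at hf hg hfg
    have hS' := shortExact_of_linearMap (f := LinearMap.inl R F B ∘ₗ f.hom)
      (g := e.symm.toLinearMap ∘ₗ g.hom.prodMap LinearMap.id)
      (LinearMap.inl_injective.comp hf)
      (e.symm.surjective.comp (hg.prodMap surjective_id)) (by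
        rintro ⟨a, b⟩
        change e.symm (g.hom a, b) = 0 ↔ _
        rw [e.symm.map_eq_zero_iff, Prod.mk_eq_zero, hfg a]
        simp [eq_comm])
    exact ⟨K, .of R (F × B), _, _, _, inferInstanceAs (Module.Free R (F × B)), hS', hK⟩

variable (R M) in
/-- `M` is right orthogonal to all finitely generated totally reflexive modules. -/
def PerpTotallyReflexive : Prop :=
  ∀ G : ModuleCat.{u} R, Module.Finite R G → TotallyReflexive R G → ExtVanish R G M

namespace PerpTotallyReflexive

theorem of_finite_projective [Module.Finite R M] [Projective R M] : PerpTotallyReflexive R M := by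
  intro G _ hG
  obtain ⟨m, i, s, -, -, hs⟩ := Module.Finite.exists_comp_eq_id_of_projective R M
  exact (((totallyReflexive_iff G).1 hG).2.1.pi (ι := Fin m)).of_retract_right s i hs

theorem left_of_shortExact [IsNoetherianRing R] (hB : PerpTotallyReflexive R B)
    (hC : PerpTotallyReflexive R C) (hf : Injective f) (hg : Surjective g) (hfg : Exact f g) :
    PerpTotallyReflexive R A := by
  intro G _ hG n
  obtain ⟨F, G', i, p, _, _, hG', hi, hp, hip⟩ := TotallyReflexive.exists_embedding (M := G) hG
  have := Module.Finite.of_surjective p hp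
  exact ExtVanish.subsingleton_ext_of_projective_middle hi hp hip n
    (ExtVanish.subsingleton_ext_left hf hg hfg (hB G' this hG') (hC G' this hG') n)

theorem right_of_shortExact (hA : PerpTotallyReflexive R A) (hB : PerpTotallyReflexive R B)
    (hf : Injective f) (hg : Surjective g) (hfg : Exact f g) : PerpTotallyReflexive R C :=
  fun G hfin hG => ExtVanish.of_shortExact_right hf hg hfg (hA G hfin hG) (hB G hfin hG)

theorem projective [IsNoetherianRing R] [Module.Finite R M] (h : PerpTotallyReflexive R M)
    (hM : TotallyReflexive R (.of R M)) : Projective R M := by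
  obtain ⟨F, G, i, p, _, _, hG, hi, hp, hip⟩ := hM.exists_embedding
  have := Module.Finite.of_surjective p hp
  obtain ⟨s, hs⟩ := (h G this hG).exists_extension hi hp hip LinearMap.id
  exact Projective.of_split i s hs

end PerpTotallyReflexive

end TotallyReflexiveModules

section ProjectiveDimension

open Module Function

variable {R}
variable {X P Z : Type u} [AddCommGroup X] [Module R X] [AddCommGroup P] [Module R P]
  [AddCommGroup Z] [Module R Z]

/-- A module right orthogonal to the totally reflexive modules has finite projective dimension if
its sum with some projective module has finite Gorenstein dimension. -/
theorem PerpTotallyReflexive.hasProjectiveDimensionLE [IsNoetherianRing R] {n : ℕ}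
    [Module.Finite R X] [Projective R P] (hX : PerpTotallyReflexive R X) (e : Z ≃ₗ[R] X × P)
    (hZ : GdimLE R n (.of R Z)) : HasProjectiveDimensionLE (ModuleCat.of R X) n := by
  induction n generalizing X P Z with
  | zero =>
    have := hX.projective (TotallyReflexive.of_retract hZ (e.symm.toLinearMap ∘ₗ .inl R X P)
      (.fst R X P ∘ₗ e.toLinearMap) (by ext; simp))
    rw [← projective_iff_hasProjectiveDimensionLE_zero]
    exact (IsProjective.iff_projective X).1 this
  | succ n ih =>
    obtain ⟨K, F, f, g, w, hF, hS, hK⟩ := hZ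
    have hfg := (ShortComplex.ShortExact.moduleCat_exact_iff_function_exact _).1 hS.exact
    have hf := hS.moduleCat_injective_f
    have hg := hS.moduleCat_surjective_g
    dsimp at hf hg hfg
    obtain ⟨m, h, hh⟩ := Module.Finite.exists_fin' R X
    let π : F →ₗ[R] X := .fst R X P ∘ₗ e.toLinearMap ∘ₗ g.hom
    let ρ : F →ₗ[R] P := .snd R X P ∘ₗ e.toLinearMap ∘ₗ g.hom
    have hρ : Surjective ρ := (Prod.snd_surjective (α := X)).comp (e.surjective.comp hg)
    obtain ⟨eF⟩ := ρ.exact_subtype_ker_map.nonempty_equiv_prod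
      (LinearMap.ker ρ).injective_subtype hρ
    have : Projective R (LinearMap.ker ρ) :=
      Module.Projective.of_split (eF.symm.toLinearMap ∘ₗ LinearMap.inl R (LinearMap.ker ρ) P)
        (LinearMap.fst R (LinearMap.ker ρ) P ∘ₗ eF.toLinearMap)
        (by ext; simp)
    have hsub := (LinearMap.ker h).injective_subtype
    have hker := h.exact_subtype_ker_map
    -- the pullback of `ker ρ → X ← (Fin m → R)`
    let E : Submodule R (LinearMap.ker ρ × (Fin m → R)) :=
      LinearMap.ker ((π ∘ₗ (LinearMap.ker ρ).subtype).coprod (-h))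
    have hE (x) : x ∈ E ↔ π x.1 = h x.2 := by
      simp [E, add_neg_eq_zero]
    have hfρ (k : K) : ρ (f k) = 0 := by simp [ρ, hfg.apply_apply_eq_zero]
    have hfπ (k : K) : π (f k) = 0 := by simp [π, hfg.apply_apply_eq_zero]
    let iK : K →ₗ[R] E := LinearMap.codRestrict E
      (.inl R _ _ ∘ₗ f.hom.codRestrict (LinearMap.ker ρ) hfρ) fun k =>
        (hE _).2 ((hfπ k).trans h.map_zero.symm)
    let ik : LinearMap.ker h →ₗ[R] E := LinearMap.codRestrict E
      (.inr R _ _ ∘ₗ (LinearMap.ker h).subtype) fun k => (hE _).2 (by simp)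
    obtain ⟨e₁⟩ := Function.Exact.nonempty_equiv_prod (f := iK)
      (g := .snd R _ _ ∘ₗ E.subtype)
      (fun x y hxy => hf (congr_arg (fun z => (z.1.1 : F)) hxy))
      (fun b => by
        obtain ⟨a, ha⟩ := hg (e.symm (h b, 0))
        have hπa : π a = h b := by simp [π, ha]
        have hρa : ρ a = 0 := by simp [ρ, ha]
        exact ⟨⟨(⟨a, hρa⟩, b), (hE _).2 hπa⟩, rfl⟩)
      (by
        rintro ⟨⟨⟨a, ha⟩, b⟩, hab⟩
        constructor
        · rintro rfl
          have hπa : π a = 0 := by simpa using (hE _).1 hab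
          obtain ⟨k, rfl⟩ := (hfg a).1 (e.map_eq_zero_iff.1 (Prod.ext hπa ha))
          exact ⟨k, rfl⟩
        · rintro ⟨k, hk⟩
          exact congr_arg (fun z => z.1.2) hk.symm)
    obtain ⟨e₂⟩ := Function.Exact.nonempty_equiv_prod (f := ik)
      (g := .fst R _ _ ∘ₗ E.subtype)
      (fun x y hxy => Subtype.ext (congr_arg (fun z => z.1.2) hxy))
      (fun a => by
        obtain ⟨b, hb⟩ := hh (π a)
        exact ⟨⟨(a, b), (hE _).2 hb.symm⟩, rfl⟩)
      (by
        rintro ⟨⟨a, b⟩, hab⟩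
        constructor
        · rintro rfl
          have hb : h b = 0 := by simpa using ((hE _).1 hab).symm
          exact ⟨⟨b, hb⟩, rfl⟩
        · rintro ⟨k, hk⟩
          exact congr_arg (fun z => z.1.1) hk.symm)
    have := ih (hX := PerpTotallyReflexive.left_of_shortExact .of_finite_projective hX hsub hh hker)
      e₂ (hK.of_equiv_prod e₁)
    exact (shortExact_of_linearMap hsub hh hker).hasProjectiveDimensionLT_X₃ (n + 1) this
      (have : Projective (ModuleCat.of R (Fin m → R)) :=
        (IsProjective.iff_projective _).1 inferInstance
       inferInstance)

theorem PerpTotallyReflexive.of_hasProjectiveDimensionLE [IsNoetherianRing R] {n : ℕ}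
    [Module.Finite R X] (h : HasProjectiveDimensionLE (ModuleCat.of R X) n) :
    PerpTotallyReflexive R X := by
  induction n generalizing X with
  | zero =>
    rw [← projective_iff_hasProjectiveDimensionLE_zero] at h
    have := (IsProjective.iff_projective X).2 h
    exact .of_finite_projective
  | succ n ih =>
    obtain ⟨m, p, hp⟩ := Module.Finite.exists_fin' R X
    have hsub := (LinearMap.ker p).injective_subtype
    have hker := p.exact_subtype_ker_map
    have : Projective (ModuleCat.of R (Fin m → R)) :=
        (IsProjective.iff_projective _).1 inferInstance
    exact .right_of_shortExact (ih ((shortExact_of_linearMap hsub hp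
      hker).hasProjectiveDimensionLT_X₁ (n + 1) inferInstance h)) .of_finite_projective hsub hp hker

theorem projDimLE_iff (n : ℕ) (X : ModuleCat.{u} R) :
    ProjDimLE R n X ↔ HasProjectiveDimensionLE X n := by
  induction n generalizing X with
  | zero => exact projective_iff_hasProjectiveDimensionLE_zero X
  | succ n ih =>
    constructor
    · rintro ⟨K, F, f, g, w, hF, hS, hK⟩
      have := Module.Projective.of_free (R := R) (P := F)
      have : CategoryTheory.Projective F := (IsProjective.iff_projective F).1 this
      exact (hS.hasProjectiveDimensionLT_X₃_iff n this).2 ((ih K).1 hK)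
    · intro h
      have hS := X.shortExact_projectiveShortComplex
      have : Module.Free R X.projectiveShortComplex.X₂ := inferInstance
      exact ⟨_, _, _, _, _, this, hS, (ih _).2 ((hS.hasProjectiveDimensionLT_X₃_iff n
        ((IsProjective.iff_projective _).1 Module.Projective.of_free)).1 h)⟩

theorem projDim_ne_top_iff (X : ModuleCat.{u} R) :
    projDim R X ≠ ⊤ ↔ ∃ n, ProjDimLE R n X := by
  simp [projDim, sInf_eq_top]

theorem Gdim_ne_top_iff (X : ModuleCat.{u} R) : Gdim R X ≠ ⊤ ↔ ∃ n, GdimLE R n X := by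
  simp [Gdim, sInf_eq_top]

end ProjectiveDimension

theorem stmt3 (R : Type u) [CommRing R] [IsNoetherianRing R] [IsLocalRing R]
    (X : ModuleCat.{u} R) (hfg : Module.Finite R X) (hGdim : Gdim R X ≠ ⊤) :
    (∀ G : ModuleCat.{u} R, Module.Finite R G → TotallyReflexive R G →
        ∀ i : ℕ, 0 < i → Subsingleton (ExtMod R i G X)) ↔ projDim R X ≠ ⊤ := by
  have key : (∀ G : ModuleCat.{u} R, Module.Finite R G → TotallyReflexive R G →
      ∀ i : ℕ, 0 < i → Subsingleton (ExtMod R i G X)) ↔ PerpTotallyReflexive R X :=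
    forall₃_congr fun G _ _ => (extVanish_iff G X).symm
  rw [key, projDim_ne_top_iff]
  obtain ⟨n, hn⟩ := (Gdim_ne_top_iff X).1 hGdim
  constructor
  · intro h
    exact ⟨n, (projDimLE_iff n X).2 (h.hasProjectiveDimensionLE
      (LinearEquiv.prodUnique (R := R) (M := X) (M₂ := PUnit.{u + 1})).symm hn)⟩
  · rintro ⟨k, hk⟩
    exact .of_hasProjectiveDimensionLE ((projDimLE_iff k X).1 hk)
end
end

section
/- Let (Q,n) be a local ring, x ∈ n a regular element, R = Q/(x), and M a finitely generated R-module with G-dim_Q(M) < ∞. Given a projective hull 0 → M → X → G → 0 of M over R (with G totally reflexive over R and pd_R(X) = G-dim_R(M)), there exist Q-modules X̃ and G̃ with G̃ totally reflexive over Q, pd_Q(X̃) = G-dim_R(M), and an exact sequence 0 → X̃ → G̃ → M → 0 of Q-modules. -/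
open CategoryTheory

noncomputable section

universe u

variable (R : Type u) [CommRing R]

namespace HullLift

/-- A short exact sequence of modules, as a property of a pair of linear maps. -/
structure SES {A : Type u} [CommRing A] {K F M : Type u} [AddCommGroup K] [AddCommGroup F]
    [AddCommGroup M] [Module A K] [Module A F] [Module A M]
    (f : K →ₗ[A] F) (g : F →ₗ[A] M) : Prop where
  inj : Function.Injective f
  exact : Function.Exact f g
  surj : Function.Surjective g

section Ext

variable {A : Type u} [CommRing A]

lemma subsingleton_extMod_iff (X Y : ModuleCat.{u} A) (n : ℕ) :
    Subsingleton (ExtMod A (n + 1) X Y) ↔ Subsingleton (Abelian.Ext X Y (n + 1)) := by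
  let P := projectiveResolution X
  have h1 : Subsingleton (ExtMod A (n + 1) X Y) ↔
      ∀ f : P.complex.X (n + 1) ⟶ Y, P.complex.d (n + 2) (n + 1) ≫ f = 0 →
        ∃ g : P.complex.X n ⟶ Y, P.complex.d (n + 1) n ≫ g = f := by
    rw [← ModuleCat.isZero_iff_subsingleton, (P.isoExt (R := A) (n + 1) Y).isZero_iff,
      ← HomologicalComplex.exactAt_iff_isZero_homology,
      HomologicalComplex.exactAt_iff' _ n (n + 1) (n + 2) (by simp) (by simp),
      ShortComplex.moduleCat_exact_iff]
    rfl
  rw [h1]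
  constructor
  · intro h
    refine subsingleton_of_forall_eq 0 fun e ↦ ?_
    obtain ⟨f, hf, rfl⟩ := P.extMk_surjective e (n + 2) rfl
    exact (P.extMk_eq_zero_iff f (n + 2) rfl hf n rfl).2 (h f hf)
  · intro h f hf
    exact (P.extMk_eq_zero_iff f (n + 2) rfl hf n rfl).1 (Subsingleton.elim _ _)

/-- Vanishing of `Ext^i(M, A)`. -/
def ExtVan (A : Type u) [CommRing A] (M : Type u) [AddCommGroup M] [Module A M] (i : ℕ) : Prop :=
  Subsingleton (Abelian.Ext (ModuleCat.of A M) (ModuleCat.of A A) i)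

variable {K F M : Type u} [AddCommGroup K] [AddCommGroup F] [AddCommGroup M]
  [Module A K] [Module A F] [Module A M] {f : K →ₗ[A] F} {g : F →ₗ[A] M}

lemma SES.comp_eq_zero (h : SES f g) : g ∘ₗ f = 0 := h.exact.linearMap_comp_eq_zero

lemma SES.shortExact (h : SES f g) :
    (ShortComplex.mk (ModuleCat.ofHom f) (ModuleCat.ofHom g)
      (by rw [← ModuleCat.ofHom_comp, h.comp_eq_zero]; rfl)).ShortExact where
  exact := (ShortComplex.ShortExact.moduleCat_exact_iff_function_exact _).2 h.exact
  mono_f := (ModuleCat.mono_iff_injective _).2 h.inj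
  epi_g := (ModuleCat.epi_iff_surjective _).2 h.surj

lemma SES.of_shortExact {S : ShortComplex (ModuleCat.{u} A)} (h : S.ShortExact) :
    SES S.f.hom S.g.hom where
  inj := (ModuleCat.mono_iff_injective _).1 h.mono_f
  exact := (ShortComplex.ShortExact.moduleCat_exact_iff_function_exact _).1 h.exact
  surj := (ModuleCat.epi_iff_surjective _).1 h.epi_g

lemma ExtVan.of_projective [Module.Projective A M] (i : ℕ) : ExtVan A M (i + 1) := by
  have : Projective (ModuleCat.of A M) := (IsProjective.iff_projective M).1 ‹_›
  exact Abelian.Ext.subsingleton_of_projective _ _ i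

lemma SES.extVan_mid (h : SES f g) {i : ℕ} (h₁ : ExtVan A K i) (h₃ : ExtVan A M i) :
    ExtVan A F i := by
  refine subsingleton_of_forall_eq 0 fun e ↦ ?_
  obtain ⟨y, rfl⟩ := Abelian.Ext.contravariant_sequence_exact₂ h.shortExact _ e (h₁.elim _ _)
  rw [h₃.elim y 0, Abelian.Ext.comp_zero]

lemma SES.extVan_right (h : SES f g) {i : ℕ} (h₁ : ExtVan A K i) (h₂ : ExtVan A F (i + 1)) :
    ExtVan A M (i + 1) := by
  refine subsingleton_of_forall_eq 0 fun e ↦ ?_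
  obtain ⟨y, rfl⟩ := Abelian.Ext.contravariant_sequence_exact₃ h.shortExact _ e (h₂.elim _ _)
    (add_comm 1 i)
  rw [h₁.elim y 0, Abelian.Ext.comp_zero]

lemma SES.extVan_left (h : SES f g) {i : ℕ} (h₂ : ExtVan A F i) (h₃ : ExtVan A M (i + 1)) :
    ExtVan A K i := by
  refine subsingleton_of_forall_eq 0 fun e ↦ ?_
  obtain ⟨y, rfl⟩ := Abelian.Ext.contravariant_sequence_exact₁ h.shortExact _ e (add_comm 1 i)
    (h₃.elim _ _)
  rw [h₂.elim y 0, Abelian.Ext.comp_zero]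

lemma SES.exists_extend (h : SES f g) (h₃ : ExtVan A M 1) (φ : K →ₗ[A] A) :
    ∃ ψ : F →ₗ[A] A, ψ ∘ₗ f = φ := by
  obtain ⟨y, hy⟩ := Abelian.Ext.contravariant_sequence_exact₁ h.shortExact _
    (Abelian.Ext.mk₀ (ModuleCat.ofHom φ)) (add_comm 1 0) (h₃.elim _ _)
  obtain ⟨ψ, rfl⟩ := (Abelian.Ext.mk₀_bijective _ _).2 y
  rw [Abelian.Ext.mk₀_comp_mk₀] at hy
  exact ⟨ψ.hom, congrArg ModuleCat.Hom.hom ((Abelian.Ext.mk₀_bijective _ _).1 hy)⟩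

lemma SES.extVan_one (h : SES f g) (h₂ : ExtVan A F 1)
    (H : ∀ φ : K →ₗ[A] A, ∃ ψ : F →ₗ[A] A, ψ ∘ₗ f = φ) : ExtVan A M 1 := by
  refine subsingleton_of_forall_eq 0 fun e ↦ ?_
  obtain ⟨y, rfl⟩ := Abelian.Ext.contravariant_sequence_exact₃ h.shortExact _ e (h₂.elim _ _)
    (add_comm 1 0)
  obtain ⟨φ, rfl⟩ := (Abelian.Ext.mk₀_bijective _ _).2 y
  obtain ⟨ψ, hψ⟩ := H φ.hom
  have : φ = ModuleCat.ofHom f ≫ ModuleCat.ofHom ψ :=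
    ModuleCat.hom_ext hψ.symm
  rw [this, ← Abelian.Ext.mk₀_comp_mk₀]
  exact h.shortExact.extClass_comp_assoc _

lemma ExtVan.of_retract {i : ℕ} (s : M →ₗ[A] F) (r : F →ₗ[A] M) (hrs : r ∘ₗ s = .id)
    (h : ExtVan A F i) : ExtVan A M i := by
  refine subsingleton_of_forall_eq 0 fun e ↦ ?_
  have : (Abelian.Ext.mk₀ (ModuleCat.ofHom s)).comp
      ((Abelian.Ext.mk₀ (ModuleCat.ofHom r)).comp e (zero_add i)) (zero_add i) = e := by
    rw [Abelian.Ext.mk₀_comp_mk₀_assoc, ← ModuleCat.ofHom_comp, hrs]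
    exact Abelian.Ext.mk₀_id_comp e
  rw [← this, h.elim ((Abelian.Ext.mk₀ (ModuleCat.ofHom r)).comp e (zero_add i)) 0,
    Abelian.Ext.comp_zero]

end Ext

section LinearAlgebra

variable {A : Type u} [CommRing A]

lemma exists_factor_surjective {M N L : Type*} [AddCommGroup M] [AddCommGroup N] [AddCommGroup L]
    [Module A M] [Module A N] [Module A L] (s : M →ₗ[A] N) (hs : Function.Surjective s)
    (ψ : M →ₗ[A] L) (h : ∀ m, s m = 0 → ψ m = 0) : ∃ χ : N →ₗ[A] L, ∀ m, χ (s m) = ψ m := by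
  refine ⟨(LinearMap.ker s).liftQ ψ h ∘ₗ (s.quotKerEquivOfSurjective hs).symm.toLinearMap,
    fun m ↦ ?_⟩
  have : (s.quotKerEquivOfSurjective hs).symm (s m) = Submodule.Quotient.mk m := by
    rw [LinearEquiv.symm_apply_eq]; rfl
  simp only [LinearMap.comp_apply, LinearEquiv.coe_coe, this]
  exact (LinearMap.ker s).liftQ_apply ψ m

lemma exists_factor_injective {M N L : Type*} [AddCommGroup M] [AddCommGroup N] [AddCommGroup L]
    [Module A M] [Module A N] [Module A L] (j : N →ₗ[A] L) (hj : Function.Injective j)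
    (ψ : M →ₗ[A] L) (h : ∀ m, ∃ n, j n = ψ m) : ∃ χ : M →ₗ[A] N, ∀ m, j (χ m) = ψ m := by
  choose χ hχ using h
  exact ⟨{ toFun := χ
           map_add' := fun a b ↦ hj (by simp [hχ])
           map_smul' := fun c a ↦ hj (by simp [hχ]) }, hχ⟩

variable {K F M : Type u} [AddCommGroup K] [AddCommGroup F] [AddCommGroup M]
  [Module A K] [Module A F] [Module A M]

lemma SES.ker {g : F →ₗ[A] M} (hg : Function.Surjective g) : SES (LinearMap.ker g).subtype g where
  inj := Subtype.val_injective
  exact := LinearMap.exact_subtype_ker_map g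
  surj := hg

lemma SES.prod (A M N : Type u) [CommRing A] [AddCommGroup M] [AddCommGroup N] [Module A M]
    [Module A N] : SES (LinearMap.inl A M N) (LinearMap.snd A M N) where
  inj := LinearMap.inl_injective
  exact := Function.Exact.inl_snd
  surj := LinearMap.snd_surjective

lemma SES.comp_equiv {f : K →ₗ[A] F} {g : F →ₗ[A] M} (h : SES f g) {N : Type u} [AddCommGroup N]
    [Module A N] (e : M ≃ₗ[A] N) : SES f (e.toLinearMap ∘ₗ g) where
  inj := h.inj
  exact y := by simpa using h.exact y
  surj := e.surjective.comp h.surj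

lemma SES.equiv_comp {f : K →ₗ[A] F} {g : F →ₗ[A] M} (h : SES f g) {N : Type u} [AddCommGroup N]
    [Module A N] (e : N ≃ₗ[A] K) : SES (f ∘ₗ e.toLinearMap) g where
  inj := h.inj.comp e.injective
  exact y := by
    rw [h.exact y]
    constructor
    · rintro ⟨k, rfl⟩; exact ⟨e.symm k, by simp⟩
    · rintro ⟨k, rfl⟩; exact ⟨e k, rfl⟩
  surj := h.surj

lemma SES.finite_left [IsNoetherianRing A] [Module.Finite A F] {f : K →ₗ[A] F} {g : F →ₗ[A] M}
    (h : SES f g) : Module.Finite A K := Module.Finite.of_injective f h.inj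

lemma SES.finite_right [Module.Finite A F] {f : K →ₗ[A] F} {g : F →ₗ[A] M}
    (h : SES f g) : Module.Finite A M := Module.Finite.of_surjective g h.surj

/-- A cover of the quotient of a short exact sequence lifts to one of the middle term with the
same kernel. -/
lemma SES.exists_lift_cover {i : K →ₗ[A] F} {q : F →ₗ[A] M} (h : SES i q)
    {L P : Type u} [AddCommGroup L] [AddCommGroup P] [Module A L] [Module A P]
    [Module.Projective A P] {k : L →ₗ[A] P} {p : P →ₗ[A] M} (hp : SES k p) :
    ∃ (a : L →ₗ[A] K × P) (b : K × P →ₗ[A] F), SES a b := by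
  obtain ⟨φ, hφ⟩ := Module.projective_lifting_property q p h.surj
  have hφ' (x : P) : q (φ x) = p x := LinearMap.congr_fun hφ x
  obtain ⟨s, hs⟩ := exists_factor_injective i h.inj (φ ∘ₗ k) fun m ↦ (h.exact _).1 (by
    rw [LinearMap.comp_apply, hφ']; exact (hp.exact _).2 ⟨m, rfl⟩)
  simp only [LinearMap.comp_apply] at hs
  refine ⟨(-s).prod k, i.coprod φ, ⟨fun x y hxy ↦ hp.inj (Prod.ext_iff.1 hxy).2, ?_, ?_⟩⟩
  · rintro ⟨a, x⟩
    constructor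
    · intro hax
      simp only [LinearMap.coprod_apply] at hax
      obtain ⟨l, rfl⟩ := (hp.exact x).1 (by
        rw [← hφ', eq_neg_of_add_eq_zero_right hax, map_neg,
          (h.exact _).2 ⟨a, rfl⟩, neg_zero])
      refine ⟨l, Prod.ext (h.inj ?_) rfl⟩
      change i (-s l) = i a
      rw [map_neg, hs]
      exact (eq_neg_of_add_eq_zero_left hax).symm
    · rintro ⟨l, hl⟩
      obtain ⟨rfl, rfl⟩ := Prod.ext_iff.1 hl
      change i (-s l) + φ (k l) = 0
      rw [map_neg, hs, neg_add_cancel]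
  · intro y
    obtain ⟨x, hx⟩ := hp.surj (q y)
    obtain ⟨a, ha⟩ := (h.exact (y - φ x)).1 (by simp [hφ', hx])
    exact ⟨(a, x), by simp [ha]⟩

lemma SES.exists_ker_comp {f : K →ₗ[A] F} {g : F →ₗ[A] M} (h : SES f g) {P : Type u}
    [AddCommGroup P] [Module A P] {p : P →ₗ[A] F} (hp : Function.Surjective p) :
    ∃ (a : LinearMap.ker p →ₗ[A] LinearMap.ker (g ∘ₗ p)) (b : LinearMap.ker (g ∘ₗ p) →ₗ[A] K),
      SES a b := by
  obtain ⟨b, hb⟩ := exists_factor_injective f h.inj (p ∘ₗ (LinearMap.ker (g ∘ₗ p)).subtype)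
    fun m ↦ (h.exact _).1 m.2
  refine ⟨Submodule.inclusion (LinearMap.ker_le_ker_comp p g), b,
    Submodule.inclusion_injective _, fun y ↦ ?_, fun k ↦ ?_⟩
  · rw [← map_eq_zero_iff f h.inj, hb]
    exact ⟨fun hy ↦ ⟨⟨y, hy⟩, rfl⟩, by rintro ⟨z, rfl⟩; exact z.2⟩
  · obtain ⟨x, hx⟩ := hp (f k)
    refine ⟨⟨x, ?_⟩, h.inj ?_⟩
    · rw [LinearMap.mem_ker, LinearMap.comp_apply, hx, h.exact.apply_apply_eq_zero]
    · rw [hb]; exact hx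

lemma SES.nonempty_equiv_prod {i : K →ₗ[A] F} {q : F →ₗ[A] M} (h : SES i q)
    [Module.Projective A M] : Nonempty (F ≃ₗ[A] K × M) := by
  obtain ⟨l, hl⟩ := Module.projective_lifting_property q .id h.surj
  exact ⟨(h.exact.splitSurjectiveEquiv h.inj ⟨l, hl⟩).1⟩

lemma exists_ses_pi (A M : Type u) [CommRing A] [AddCommGroup M] [Module A M] [Module.Finite A M] :
    ∃ (n : ℕ) (g : (Fin n → A) →ₗ[A] M), SES (LinearMap.ker g).subtype g := by
  obtain ⟨n, g, hg⟩ := Module.Finite.exists_fin' A M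
  exact ⟨n, g, SES.ker hg⟩

instance finite_dual [IsNoetherianRing A] [Module.Finite A M] :
    Module.Finite A (Module.Dual A M) := by
  obtain ⟨n, g, hg⟩ := Module.Finite.exists_fin' A M
  exact Module.Finite.of_injective g.dualMap (LinearMap.dualMap_injective_of_surjective hg)

end LinearAlgebra

section TotallyReflexive

variable {A : Type u} [CommRing A]

/-- Unbundled form of total reflexivity. -/
structure IsTR (A : Type u) [CommRing A] (M : Type u) [AddCommGroup M] [Module A M] : Prop where
  bij : Function.Bijective (Module.Dual.eval A M)
  van (i : ℕ) : ExtVan A M (i + 1)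
  dual (i : ℕ) : ExtVan A (Module.Dual A M) (i + 1)

lemma totallyReflexive_iff (M : ModuleCat.{u} A) : TotallyReflexive A M ↔ IsTR A M := by
  have key (N : ModuleCat.{u} A) : (∀ i : ℕ, 0 < i → Subsingleton (ExtMod A i N (.of A A))) ↔
      ∀ i, ExtVan A N (i + 1) :=
    ⟨fun h i ↦ (subsingleton_extMod_iff _ _ i).1 (h (i + 1) i.succ_pos), fun h i hi ↦ by
      obtain ⟨j, rfl⟩ := Nat.exists_eq_succ_of_ne_zero hi.ne'
      exact (subsingleton_extMod_iff _ _ j).2 (h j)⟩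
  exact ⟨fun h ↦ ⟨h.1, (key _).1 h.2.1, (key (.of A (Module.Dual A M))).1 h.2.2⟩,
    fun h ↦ ⟨h.bij, (key _).2 h.van, (key (.of A (Module.Dual A M))).2 h.dual⟩⟩

variable {K F M : Type u} [AddCommGroup K] [AddCommGroup F] [AddCommGroup M]
  [Module A K] [Module A F] [Module A M] {f : K →ₗ[A] F} {g : F →ₗ[A] M}

lemma ExtVan.congr {N : Type u} [AddCommGroup N] [Module A N] {i : ℕ}
    (e : M ≃ₗ[A] N) (h : ExtVan A M i) : ExtVan A N i :=
  h.of_retract e.symm.toLinearMap e.toLinearMap (by ext; simp)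

lemma IsTR.exists_eval (h : IsTR A M) (ψ : Module.Dual A (Module.Dual A M)) :
    ∃ m, ∀ φ : Module.Dual A M, ψ φ = φ m := by
  obtain ⟨m, rfl⟩ := h.bij.2 ψ
  exact ⟨m, fun φ ↦ rfl⟩

lemma IsTR.eq_zero (h : IsTR A M) {m : M} (hm : ∀ φ : Module.Dual A M, φ m = 0) : m = 0 :=
  h.bij.1 (by ext φ; simpa using hm φ)

lemma bijective_eval (h₀ : ∀ m : M, (∀ φ : Module.Dual A M, φ m = 0) → m = 0)
    (h₁ : ∀ ψ : Module.Dual A (Module.Dual A M), ∃ m, ∀ φ : Module.Dual A M, ψ φ = φ m) :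
    Function.Bijective (Module.Dual.eval A M) := by
  refine ⟨(injective_iff_map_eq_zero _).2 fun m hm ↦ h₀ m fun φ ↦ LinearMap.congr_fun hm φ,
    fun ψ ↦ ?_⟩
  obtain ⟨m, hm⟩ := h₁ ψ
  exact ⟨m, by ext φ; exact (hm φ).symm⟩

/-- The dual of a short exact sequence with vanishing `Ext¹`. -/
lemma SES.dual (h : SES f g) (H : ∀ φ : K →ₗ[A] A, ∃ ψ : F →ₗ[A] A, ψ ∘ₗ f = φ) :
    SES g.dualMap f.dualMap where
  inj := LinearMap.dualMap_injective_of_surjective h.surj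
  exact φ := by
    constructor
    · intro hφ
      obtain ⟨χ, hχ⟩ := exists_factor_surjective g h.surj φ fun x hx ↦ by
        obtain ⟨k, rfl⟩ := (h.exact x).1 hx
        exact LinearMap.congr_fun hφ k
      exact ⟨χ, LinearMap.ext hχ⟩
    · rintro ⟨χ, rfl⟩
      ext k
      simp [h.exact.apply_apply_eq_zero]
  surj := H

lemma IsTR.of_projective [Module.Finite A M] [Module.Projective A M] : IsTR A M where
  bij := Module.bijective_dual_eval A M
  van i := .of_projective i
  dual i := .of_projective i

lemma SES.isTR_mid (h : SES f g) (h₁ : IsTR A K) (h₃ : IsTR A M) : IsTR A F where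
  bij := by
    have hd := h.dual (h.exists_extend (h₃.van 0))
    refine bijective_eval (fun y hy ↦ ?_) fun ψ ↦ ?_
    · obtain ⟨k, rfl⟩ := (h.exact y).1 (h₃.eq_zero fun φ ↦ hy (φ ∘ₗ g))
      have hk : k = 0 := h₁.eq_zero fun φ ↦ by
        obtain ⟨χ, rfl⟩ := hd.surj φ
        exact hy χ
      rw [hk, map_zero]
    · obtain ⟨m, hm⟩ := h₃.exists_eval (ψ ∘ₗ g.dualMap)
      obtain ⟨y, rfl⟩ := h.surj m
      obtain ⟨χ, hχ⟩ := exists_factor_surjective f.dualMap hd.surj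
        (ψ - Module.Dual.eval A F y) fun φ hφ ↦ by
          obtain ⟨θ, rfl⟩ := (hd.exact φ).1 hφ
          have := hm θ
          simp only [LinearMap.comp_apply] at this
          simp [this]
      obtain ⟨k, hk⟩ := h₁.exists_eval χ
      refine ⟨y + f k, fun φ ↦ ?_⟩
      have := hχ φ
      rw [hk] at this
      simp only [LinearMap.sub_apply, Module.Dual.eval_apply, LinearMap.dualMap_apply] at this
      rw [map_add, this]; abel
  van i := h.extVan_mid (h₁.van i) (h₃.van i)
  dual i := (h.dual (h.exists_extend (h₃.van 0))).extVan_mid (h₃.dual i) (h₁.dual i)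

lemma IsTR.of_retract (s : M →ₗ[A] F) (r : F →ₗ[A] M) (hrs : r ∘ₗ s = .id) (h : IsTR A F) :
    IsTR A M where
  bij := by
    have hrs' (m : M) : r (s m) = m := LinearMap.congr_fun hrs m
    refine bijective_eval (fun m hm ↦ ?_) fun ψ ↦ ?_
    · rw [← hrs' m, h.eq_zero fun φ ↦ hm (φ ∘ₗ s), map_zero]
    · obtain ⟨y, hy⟩ := h.exists_eval (ψ ∘ₗ s.dualMap)
      refine ⟨r y, fun φ ↦ ?_⟩
      have := hy (φ ∘ₗ r)
      simp only [LinearMap.comp_apply] at this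
      rw [← this]
      congr 1
      ext m
      simp [hrs']
  van i := (h.van i).of_retract s r hrs
  dual i := (h.dual i).of_retract r.dualMap s.dualMap (by
    rw [LinearMap.dualMap_comp_dualMap, hrs, LinearMap.dualMap_id])

lemma IsTR.congr {N : Type u} [AddCommGroup N] [Module A N] (h : IsTR A M) (e : M ≃ₗ[A] N) :
    IsTR A N :=
  h.of_retract e.symm.toLinearMap e.toLinearMap (by ext; simp)

lemma IsTR.prod {N : Type u} [AddCommGroup N] [Module A N] (h : IsTR A M) (h' : IsTR A N) :
    IsTR A (M × N) :=
  (SES.prod A M N).isTR_mid h h'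

lemma IsTR.dual_isTR (h : IsTR A M) : IsTR A (Module.Dual A M) where
  bij := by
    refine bijective_eval (fun φ hφ ↦ ?_) fun ψ ↦ ?_
    · ext m; exact hφ (Module.Dual.eval A M m)
    · refine ⟨ψ ∘ₗ Module.Dual.eval A M, fun χ ↦ ?_⟩
      obtain ⟨m, rfl⟩ := h.bij.2 χ
      rfl
  van := h.dual
  dual i := ExtVan.congr (LinearEquiv.ofBijective _ h.bij) (h.van i)

/-- Syzygies of totally reflexive modules are totally reflexive. -/
lemma SES.isTR_left [Module.Finite A F] [Module.Projective A F] (h : SES f g) (h₃ : IsTR A M) :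
    IsTR A K where
  bij := by
    have hd := h.dual (h.exists_extend (h₃.van 0))
    have hF : IsTR A F := .of_projective
    refine bijective_eval (fun k hk ↦ h.inj ?_) fun ψ ↦ ?_
    · rw [map_zero]
      exact hF.eq_zero fun φ ↦ hk (φ ∘ₗ f)
    · obtain ⟨y, hy⟩ := hF.exists_eval (ψ ∘ₗ f.dualMap)
      simp only [LinearMap.comp_apply] at hy
      obtain ⟨k, rfl⟩ := (h.exact y).1 (h₃.eq_zero fun φ ↦ by
        have := hy (g.dualMap φ)
        rw [hd.exact.apply_apply_eq_zero, map_zero] at this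
        exact this.symm)
      refine ⟨k, fun φ ↦ ?_⟩
      obtain ⟨χ, rfl⟩ := hd.surj φ
      exact hy χ
  van i := h.extVan_left (.of_projective i) (h₃.van (i + 1))
  dual i := by
    have hd := h.dual (h.exists_extend (h₃.van 0))
    cases i with
    | zero =>
      refine hd.extVan_one (.of_projective 0) fun ψ ↦ ?_
      obtain ⟨m, hm⟩ := h₃.exists_eval ψ
      obtain ⟨y, rfl⟩ := h.surj m
      exact ⟨Module.Dual.eval A F y, by ext φ; exact (hm φ).symm⟩
    | succ i => exact hd.extVan_right (h₃.dual i) (.of_projective (i + 1))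

/-- A finite totally reflexive module embeds in a finite free module with totally reflexive
cokernel. -/
lemma IsTR.exists_embedding [IsNoetherianRing A] [Module.Finite A M] (h : IsTR A M) :
    ∃ (n : ℕ) (C : Type u) (_ : AddCommGroup C) (_ : Module A C) (j : M →ₗ[A] (Fin n → A))
      (q : (Fin n → A) →ₗ[A] C), SES j q ∧ IsTR A C := by
  obtain ⟨n, p, hp⟩ := exists_ses_pi A (Module.Dual A M)
  have hD := h.dual_isTR
  have hL := hp.isTR_left hD
  have e : Module.Dual A (Fin n → A) ≃ₗ[A] (Fin n → A) := (Pi.basisFun A (Fin n)).toDualEquiv.symm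
  have hd := hp.dual (hp.exists_extend (hD.van 0))
  have hd' := (hd.equiv_comp (LinearEquiv.ofBijective _ h.bij))
  refine ⟨n, Module.Dual A (LinearMap.ker p), inferInstance, inferInstance,
    e.toLinearMap ∘ₗ (p.dualMap ∘ₗ Module.Dual.eval A M),
    (LinearMap.ker p).subtype.dualMap ∘ₗ e.symm.toLinearMap, ⟨?_, ?_, ?_⟩, hL.dual_isTR⟩
  · exact e.injective.comp hd'.inj
  · intro y
    obtain ⟨z, rfl⟩ := e.surjective y
    have := hd'.exact z
    simp only [LinearMap.comp_apply, LinearEquiv.coe_coe, LinearEquiv.symm_apply_apply, this,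
      Set.mem_range, EmbeddingLike.apply_eq_iff_eq]
    rfl
  · exact hd'.surj.comp e.symm.surjective

end TotallyReflexive

section GorensteinDimension

variable {A : Type u} [CommRing A]

/-- `G-dim M ≤ n`, computed with projective instead of free modules. -/
def GProjLE (A : Type u) [CommRing A] :
    ℕ → ∀ (M : Type u) [AddCommGroup M] [Module A M], Prop
  | 0, M, _, _ => IsTR A M
  | n + 1, M, _, _ => ∃ (K P : Type u) (_ : AddCommGroup K) (_ : AddCommGroup P) (_ : Module A K)
      (_ : Module A P) (f : K →ₗ[A] P) (g : P →ₗ[A] M),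
      Module.Projective A P ∧ SES f g ∧ GProjLE A n K

variable {K F M : Type u} [AddCommGroup K] [AddCommGroup F] [AddCommGroup M]
  [Module A K] [Module A F] [Module A M] {f : K →ₗ[A] F} {g : F →ₗ[A] M} {n : ℕ}

lemma SES.gProjLE_succ (h : SES f g) [hF : Module.Projective A F] (hK : GProjLE A n K) :
    GProjLE A (n + 1) M :=
  ⟨K, F, _, _, _, _, f, g, hF, h, hK⟩

lemma GProjLE.congr {N : Type u} [AddCommGroup N] [Module A N] (h : GProjLE A n M)
    (e : M ≃ₗ[A] N) : GProjLE A n N := by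
  cases n with
  | zero => exact IsTR.congr h e
  | succ n =>
    obtain ⟨K, P, _, _, _, _, f, g, _, hs, hK⟩ := h
    exact (hs.comp_equiv e).gProjLE_succ hK

lemma GProjLE.of_prod {P : Type u} [AddCommGroup P] [Module A P] [Module.Projective A P]
    (h : GProjLE A n (M × P)) : GProjLE A n M := by
  cases n with
  | zero =>
    exact IsTR.of_retract (F := M × P) (LinearMap.inl A M P) (LinearMap.fst A M P)
      (by ext; simp) h
  | succ n =>
    obtain ⟨K, P₀, _, _, _, _, f, g, _, hs, hK⟩ := h
    let σ : P₀ →ₗ[A] P := LinearMap.snd A M P ∘ₗ g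
    have hσ (x : P₀) : σ x = (g x).2 := rfl
    have hq : SES (LinearMap.ker σ).subtype σ :=
      SES.ker ((LinearMap.snd_surjective (R := A) (M := M) (M₂ := P)).comp hs.surj)
    obtain ⟨e⟩ := hq.nonempty_equiv_prod
    have : Module.Projective A (LinearMap.ker σ) :=
      .of_split (e.symm.toLinearMap ∘ₗ LinearMap.inl A _ _)
        (LinearMap.fst A _ _ ∘ₗ e.toLinearMap) (by ext; simp)
    have h0 (k : K) : g (f k) = 0 := hs.exact.apply_apply_eq_zero k
    have hs' : SES (f.codRestrict (LinearMap.ker σ) fun k ↦ by simp [hσ, h0])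
        (LinearMap.fst A M P ∘ₗ g ∘ₗ (LinearMap.ker σ).subtype) := by
      refine ⟨fun a b hab ↦ hs.inj (congrArg Subtype.val hab), ?_, fun m ↦ ?_⟩
      · rintro ⟨x, hx⟩
        rw [LinearMap.mem_ker] at hx
        constructor
        · intro hx'
          obtain ⟨k, hk⟩ := (hs.exact x).1 (Prod.ext hx' hx)
          exact ⟨k, Subtype.ext hk⟩
        · rintro ⟨k, hk⟩
          obtain rfl := congrArg Subtype.val hk
          exact congrArg Prod.fst (h0 k)
      · obtain ⟨x, hx⟩ := hs.surj (m, 0)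
        exact ⟨⟨x, congrArg Prod.snd hx⟩, congrArg Prod.fst hx⟩
    exact hs'.gProjLE_succ hK

lemma GProjLE.prod {P : Type u} [AddCommGroup P] [Module A P] [Module.Projective A P]
    [Module.Finite A P] (h : GProjLE A n M) : GProjLE A n (M × P) := by
  cases n with
  | zero => exact IsTR.prod h .of_projective
  | succ n =>
    obtain ⟨K, P₀, _, _, _, _, f, g, _, hs, hK⟩ := h
    have h0 (k : K) : g (f k) = 0 := hs.exact.apply_apply_eq_zero k
    have hs' : SES (LinearMap.inl A P₀ P ∘ₗ f) (g.prodMap (.id : P →ₗ[A] P)) := by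
      refine ⟨LinearMap.inl_injective.comp hs.inj, ?_, hs.surj.prodMap Function.surjective_id⟩
      rintro ⟨x, y⟩
      constructor
      · intro hxy
        obtain ⟨hx, hy⟩ := Prod.ext_iff.1 hxy
        obtain ⟨k, rfl⟩ := (hs.exact x).1 hx
        exact ⟨k, Prod.ext rfl hy.symm⟩
      · rintro ⟨k, hk⟩
        obtain ⟨rfl, rfl⟩ := Prod.ext_iff.1 hk
        exact Prod.ext (h0 k) rfl
    exact hs'.gProjLE_succ hK

/-- Independence of the first syzygy (via Schanuel's lemma). -/
lemma SES.gProjLE_left (h : SES f g) [Module.Projective A F] [Module.Finite A F]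
    (hM : GProjLE A (n + 1) M) : GProjLE A n K := by
  obtain ⟨L, P, _, _, _, _, k, p, _, hs, hL⟩ := hM
  obtain ⟨a, b, hab⟩ := hs.exists_lift_cover h
  obtain ⟨e⟩ := hab.nonempty_equiv_prod
  exact (hL.prod.congr e).of_prod

lemma SES.gProjLE_iff (h : SES f g) [Module.Projective A F] [Module.Finite A F] :
    GProjLE A (n + 1) M ↔ GProjLE A n K :=
  ⟨h.gProjLE_left, h.gProjLE_succ⟩

lemma SES.gProjLE_succ_iff_of_projective_left (h : SES f g) [Module.Projective A K]
    [Module.Finite A K] [Module.Finite A M] : GProjLE A (n + 1) F ↔ GProjLE A (n + 1) M := by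
  obtain ⟨m, p, hp⟩ := exists_ses_pi A M
  obtain ⟨a, b, hab⟩ := h.exists_lift_cover hp
  rw [hab.gProjLE_iff, hp.gProjLE_iff]

variable [IsNoetherianRing A]

lemma gdimLE_iff (n : ℕ) (M : ModuleCat.{u} A) [Module.Finite A M] :
    GdimLE A n M ↔ GProjLE A n M := by
  constructor
  · suffices ∀ (n : ℕ) (M : ModuleCat.{u} A), GdimLE A n M → GProjLE A n M from this n M
    intro n
    induction n with
    | zero => exact fun M ↦ (totallyReflexive_iff M).1
    | succ n ih =>
      rintro M ⟨K, F, f, g, w, hF, hs, hK⟩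
      have : Module.Projective A F := .of_free
      exact (SES.of_shortExact hs).gProjLE_succ (ih K hK)
  · intro h
    induction n generalizing M with
    | zero => exact (totallyReflexive_iff M).2 h
    | succ n ih =>
      obtain ⟨m, p, hp⟩ := exists_ses_pi A M
      have := hp.finite_left
      exact ⟨.of A (LinearMap.ker p), .of A (Fin m → A), _, _, _,
        inferInstanceAs (Module.Free A (Fin m → A)), hp.shortExact,
        ih (.of A (LinearMap.ker p)) (hp.gProjLE_left h)⟩

lemma projDimLE_iff (n : ℕ) (M : ModuleCat.{u} A) [Module.Finite A M] :
    ProjDimLE A n M ↔ HasProjectiveDimensionLT M (n + 1) := by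
  constructor
  · suffices ∀ (n : ℕ) (M : ModuleCat.{u} A), ProjDimLE A n M →
        HasProjectiveDimensionLT M (n + 1) from this n M
    intro n
    induction n with
    | zero => exact fun M ↦ projective_iff_hasProjectiveDimensionLT_one.1
    | succ n ih =>
      rintro M ⟨K, F, f, g, w, hF, hs, hK⟩
      have hF' : Module.Projective A F := .of_free
      have : Projective F := (IsProjective.iff_projective F).1 hF'
      exact (hs.hasProjectiveDimensionLT_X₃_iff n this).2 (ih K hK)
  · intro h
    induction n generalizing M with
    | zero => exact projective_iff_hasProjectiveDimensionLT_one.2 h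
    | succ n ih =>
      obtain ⟨m, p, hp⟩ := exists_ses_pi A M
      have := hp.finite_left
      have hP : Projective (ModuleCat.of A (Fin m → A)) :=
        (IsProjective.iff_projective (Fin m → A)).1 inferInstance
      exact ⟨.of A (LinearMap.ker p), .of A (Fin m → A), _, _, _,
        inferInstanceAs (Module.Free A (Fin m → A)), hp.shortExact,
        ih (.of A (LinearMap.ker p))
          ((hp.shortExact.hasProjectiveDimensionLT_X₃_iff n hP).1 h)⟩

lemma GProjLE.of_hasProjectiveDimensionLT (n : ℕ) (M : Type u) [AddCommGroup M] [Module A M]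
    [Module.Finite A M] (h : HasProjectiveDimensionLT (ModuleCat.of A M) (n + 1)) :
    GProjLE A n M := by
  induction n generalizing M with
  | zero =>
    have : Module.Projective A M := (IsProjective.iff_projective M).2
      (projective_iff_hasProjectiveDimensionLT_one.2 h)
    exact IsTR.of_projective
  | succ n ih =>
    obtain ⟨m, p, hp⟩ := exists_ses_pi A M
    have := hp.finite_left
    have hP : Projective (ModuleCat.of A (Fin m → A)) :=
      (IsProjective.iff_projective (Fin m → A)).1 inferInstance
    exact hp.gProjLE_succ (ih _ ((hp.shortExact.hasProjectiveDimensionLT_X₃_iff n hP).1 h))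

/-- If `G` is totally reflexive and `X` has G-dimension at most `n`, then `G / X` has G-dimension
at most `n + 1`. -/
lemma SES.gProjLE_succ_of_isTR {X G : Type u} [AddCommGroup X] [AddCommGroup G] [Module A X]
    [Module A G] [Module.Finite A G] {M : Type u} [AddCommGroup M] [Module A M]
    {f : X →ₗ[A] G} {g : G →ₗ[A] M} (h : SES f g) (hG : IsTR A G) (hX : GProjLE A n X) :
    GProjLE A (n + 1) M := by
  induction n generalizing X G M with
  | zero =>
    obtain ⟨m, p, hp⟩ := exists_ses_pi A G
    have hK := SES.ker (g := g ∘ₗ p) (h.surj.comp hp.surj)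
    obtain ⟨a, b, hab⟩ : ∃ (a : LinearMap.ker p →ₗ[A] LinearMap.ker (g ∘ₗ p))
        (b : LinearMap.ker (g ∘ₗ p) →ₗ[A] X), SES a b := h.exists_ker_comp hp.surj
    exact hK.gProjLE_succ (n := 0) (hab.isTR_mid (hp.isTR_left hG) hX)
  | succ n ih =>
    obtain ⟨m, p, hp⟩ := exists_ses_pi A G
    have hK := SES.ker (g := g ∘ₗ p) (h.surj.comp hp.surj)
    obtain ⟨a, b, hab⟩ : ∃ (a : LinearMap.ker p →ₗ[A] LinearMap.ker (g ∘ₗ p))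
        (b : LinearMap.ker (g ∘ₗ p) →ₗ[A] X), SES a b := h.exists_ker_comp hp.surj
    have := h.finite_left
    have := hp.finite_left
    obtain ⟨m', p', hp'⟩ := exists_ses_pi A X
    obtain ⟨a', b', hab'⟩ := hab.exists_lift_cover hp'
    exact hK.gProjLE_succ (ih hab' ((hp.isTR_left hG).prod .of_projective) (hp'.gProjLE_left hX))

/-- Auslander–Buchweitz approximation. -/
lemma GProjLE.exists_approximation (n : ℕ) (M : Type u) [AddCommGroup M] [Module A M]
    [Module.Finite A M] (h : GProjLE A n M) :
    ∃ (X G : Type u) (_ : AddCommGroup X) (_ : AddCommGroup G) (_ : Module A X) (_ : Module A G)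
      (a : X →ₗ[A] G) (b : G →ₗ[A] M), Module.Finite A G ∧ IsTR A G ∧ SES a b ∧
        HasProjectiveDimensionLT (ModuleCat.of A X) n := by
  induction n generalizing M with
  | zero =>
    refine ⟨PUnit, M, inferInstance, inferInstance, inferInstance, inferInstance, 0, .id,
      inferInstance, h, ⟨Function.injective_of_subsingleton _, ?_, Function.surjective_id⟩, ?_⟩
    · intro y; simp [eq_comm]
    · rw [hasProjectiveDimensionLT_zero_iff_isZero, ModuleCat.isZero_iff_subsingleton]
      exact inferInstanceAs (Subsingleton PUnit)
  | succ n ih =>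
    obtain ⟨m, p, hp⟩ := exists_ses_pi A M
    have := hp.finite_left
    obtain ⟨X, G, _, _, _, _, a, b, _, hG, hab, hX⟩ := ih _ (hp.gProjLE_left h)
    obtain ⟨r, C, _, _, j, q, hjq, hC⟩ := hG.exists_embedding
    -- the pushout of the two maps out of `G`
    let d : G →ₗ[A] (Fin m → A) × (Fin r → A) := ((LinearMap.ker p).subtype ∘ₗ b).prod j
    have hd (x : G) : d x = (((b x : LinearMap.ker p) : Fin m → A), j x) := rfl
    let E := ((Fin m → A) × (Fin r → A)) ⧸ LinearMap.range d
    let π : (Fin m → A) × (Fin r → A) →ₗ[A] E := (LinearMap.range d).mkQ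
    have hπ : Function.Surjective π := (LinearMap.range d).mkQ_surjective
    have hπ0 (z) : π z = 0 ↔ ∃ x, d x = z := Submodule.Quotient.mk_eq_zero _
    have hpb (x : G) : p (b x) = 0 := (b x).2
    obtain ⟨γ, hγ⟩ := exists_factor_surjective π hπ (q ∘ₗ .snd A _ _) fun z hz ↦ by
      obtain ⟨x, rfl⟩ := (hπ0 z).1 hz
      exact hjq.exact.apply_apply_eq_zero x
    obtain ⟨β, hβ⟩ := exists_factor_surjective π hπ (p ∘ₗ .fst A _ _) fun z hz ↦ by
      obtain ⟨x, rfl⟩ := (hπ0 z).1 hz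
      exact hpb x
    have hE : SES (π ∘ₗ .inl A _ _) γ := by
      refine ⟨(injective_iff_map_eq_zero _).2 fun y hy ↦ ?_, fun z ↦ ?_, fun c ↦ ?_⟩
      · obtain ⟨x, hx⟩ := (hπ0 _).1 hy
        obtain ⟨h₁, h₂⟩ := Prod.ext_iff.1 hx
        have : x = 0 := hjq.inj (by rw [map_zero]; exact h₂)
        rw [← (show _ = y from h₁), this]
        simp [hd]
      · obtain ⟨⟨y, z⟩, rfl⟩ := hπ z
        rw [hγ]
        constructor
        · intro hz
          obtain ⟨x, rfl⟩ := (hjq.exact z).1 hz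
          refine ⟨y - b x, sub_eq_zero.1 ?_⟩
          rw [LinearMap.comp_apply, ← map_sub, hπ0]
          exact ⟨-x, by simp [hd]⟩
        · rintro ⟨y', hy'⟩
          rw [← hγ, ← hy', LinearMap.comp_apply, hγ]
          simp
      · obtain ⟨z, rfl⟩ := hjq.surj c
        exact ⟨π (0, z), hγ _⟩
    have hja : SES (j ∘ₗ a) (LinearMap.range (j ∘ₗ a)).mkQ :=
      ⟨hjq.inj.comp hab.inj, (LinearMap.exact_map_mkQ_range _), Submodule.mkQ_surjective _⟩
    obtain ⟨ι, hι⟩ := exists_factor_surjective _ hja.surj (π ∘ₗ .inr A _ _) fun z hz ↦ by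
      obtain ⟨x, rfl⟩ := (hja.exact z).1 hz
      refine (hπ0 _).2 ⟨a x, ?_⟩
      rw [hd, hab.exact.apply_apply_eq_zero]
      rfl
    refine ⟨_, E, inferInstance, inferInstance, inferInstance, inferInstance, ι, β,
      .of_surjective π hπ, hE.isTR_mid .of_projective hC, ⟨?_, ?_, ?_⟩,
      hja.shortExact.hasProjectiveDimensionLT_X₃ n hX ?_⟩
    · refine (injective_iff_map_eq_zero _).2 fun y hy ↦ ?_
      obtain ⟨z, rfl⟩ := hja.surj y
      rw [hι] at hy
      obtain ⟨x, hx⟩ := (hπ0 _).1 hy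
      obtain ⟨h₁, h₂⟩ := Prod.ext_iff.1 hx
      obtain ⟨x', rfl⟩ := (hab.exact x).1 (Subtype.ext h₁)
      exact (hja.exact z).2 ⟨x', h₂⟩
    · intro z
      obtain ⟨⟨y, z⟩, rfl⟩ := hπ z
      rw [hβ]
      constructor
      · intro hy
        obtain ⟨x, hx⟩ := hab.surj ⟨y, hy⟩
        refine ⟨(LinearMap.range (j ∘ₗ a)).mkQ (z - j x), sub_eq_zero.1 ?_⟩
        rw [hι, LinearMap.comp_apply, ← map_sub, hπ0]
        exact ⟨-x, by simp [hd, hx]⟩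
      · rintro ⟨y', hy'⟩
        obtain ⟨z', rfl⟩ := hja.surj y'
        rw [← hβ, ← hy', hι, LinearMap.comp_apply, hβ]
        simp
    · intro y
      obtain ⟨y, rfl⟩ := hp.surj y
      exact ⟨π (y, 0), hβ _⟩
    · have : Projective (ModuleCat.of A (Fin r → A)) :=
        (IsProjective.iff_projective (Fin r → A)).1 inferInstance
      exact hasProjectiveDimensionLT_of_ge (ModuleCat.of A (Fin r → A)) 1 _ (by lia)

end GorensteinDimension

section ChangeOfRings

/-- The algebra `S` is the quotient of `Q` by the regular element `x`. -/
structure IsRegularQuotient (Q S : Type u) [CommRing Q] [CommRing S] [Algebra Q S] (x : Q) :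
    Prop where
  regular : x ∈ nonZeroDivisors Q
  surjective : Function.Surjective (algebraMap Q S)
  eq_zero_iff (a : Q) : algebraMap Q S a = 0 ↔ x ∣ a

variable {Q S : Type u} [CommRing Q] [CommRing S] [Algebra Q S] {x : Q}

namespace IsRegularQuotient

variable (h : IsRegularQuotient Q S x)

include h

lemma cancel {a b : Q} (hab : x * a = x * b) : a = b :=
  (mul_cancel_left_mem_nonZeroDivisors h.regular).1 hab

lemma map_mul_eq_zero (a : Q) : algebraMap Q S (x * a) = 0 :=
  (h.eq_zero_iff _).2 (dvd_mul_right _ _)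

variable {N : Type u} [AddCommGroup N] [Module Q N]

lemma exists_div (φ : N →ₗ[Q] Q) (hφ : ∀ y, algebraMap Q S (φ y) = 0) :
    ∃ ψ : N →ₗ[Q] Q, ∀ y, x * ψ y = φ y :=
  exists_factor_injective (LinearMap.mulLeft Q x) (fun _ _ hab ↦ h.cancel hab) φ fun m ↦ by
    obtain ⟨c, hc⟩ := (h.eq_zero_iff _).1 (hφ m)
    exact ⟨c, hc.symm⟩

lemma exists_lift (hN : ExtVan Q N 1) (φ : N →ₗ[Q] S) :
    ∃ ψ : N →ₗ[Q] Q, ∀ y, algebraMap Q S (ψ y) = φ y := by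
  have hp := SES.ker (g := Finsupp.linearCombination Q (id : N → N))
    (Finsupp.linearCombination_id_surjective Q N)
  set p := Finsupp.linearCombination Q (id : N → N)
  obtain ⟨u, hu⟩ := Module.projective_lifting_property (Algebra.linearMap Q S) (φ ∘ₗ p)
    h.surjective
  replace hu (y) : algebraMap Q S (u y) = φ (p y) := LinearMap.congr_fun hu y
  obtain ⟨l, hl⟩ := h.exists_div (N := LinearMap.ker p) (u ∘ₗ (LinearMap.ker p).subtype) fun y ↦ by
    have : p y = 0 := y.2
    simp [hu, this]
  obtain ⟨e, rfl⟩ := hp.exists_extend hN l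
  obtain ⟨ψ, hψ⟩ := exists_factor_surjective p hp.surj (u - x • e) fun y hy ↦ by
    have := hl ⟨y, hy⟩
    simp only [LinearMap.comp_apply, Submodule.subtype_apply] at this
    simp [this]
  refine ⟨ψ, fun y ↦ ?_⟩
  obtain ⟨y, rfl⟩ := hp.surj y
  rw [hψ, ← hu, LinearMap.sub_apply, map_sub, LinearMap.smul_apply, smul_eq_mul,
    h.map_mul_eq_zero, sub_zero]

variable {M : Type u} [AddCommGroup M] [Module Q M] [Module S M] [IsScalarTower Q S M]

lemma exists_linear (φ : M →ₗ[Q] S) : ∃ χ : M →ₗ[S] S, ∀ m, χ m = φ m :=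
  ⟨φ.extendScalarsOfSurjective h.surjective, fun _ ↦ rfl⟩

lemma exists_factor (s : N →ₗ[Q] M) (hs : Function.Surjective s) (φ : N →ₗ[Q] S)
    (hφ : ∀ y, s y = 0 → φ y = 0) : ∃ χ : M →ₗ[S] S, ∀ y, χ (s y) = φ y := by
  obtain ⟨χ, hχ⟩ := exists_factor_surjective s hs φ hφ
  obtain ⟨χ', h'⟩ := h.exists_linear χ
  exact ⟨χ', fun y ↦ by rw [h', hχ]⟩

/-- A criterion for `Ext¹(N, Q) = 0` when `N` is an extension of an `S`-module by a projective
`Q`-module. -/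
lemma extVan_one {F : Type u} [AddCommGroup F] [Module Q F] [Module.Projective Q F]
    {j : F →ₗ[Q] N} {q : N →ₗ[Q] M} (hs : SES j q) (θ : N →ₗ[Q] F)
    (hjθ : ∀ n, j (θ n) = x • n) (hθj : ∀ y, θ (j y) = x • y)
    (H : ∀ χ : M →ₗ[S] S, ∃ v : F →ₗ[Q] Q, ∀ n, χ (q n) = algebraMap Q S (v (θ n))) :
    ExtVan Q N 1 := by
  set φ := Finsupp.linearCombination Q (id : N → N)
  have hφ : Function.Surjective φ := Finsupp.linearCombination_id_surjective Q N
  let p : (N →₀ Q) × F →ₗ[Q] N := φ.coprod j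
  have hp := SES.ker (g := p) fun n ↦ by
    obtain ⟨a, rfl⟩ := hφ n
    exact ⟨(a, 0), by simp [p]⟩
  refine hp.extVan_one (.of_projective 0) fun g ↦ ?_
  let s : (N →₀ Q) →ₗ[Q] LinearMap.ker p :=
    ((x • LinearMap.id).prod (-(θ ∘ₗ φ))).codRestrict _ fun a ↦ by simp [p, hjθ]
  have hs_apply (a) : (s a : (N →₀ Q) × F) = (x • a, -θ (φ a)) := rfl
  have hmem {a y} (hay : (a, y) ∈ LinearMap.ker p) : φ a = j (-y) := by
    rw [map_neg]
    exact eq_neg_of_add_eq_zero_left hay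
  have key (a y) (hay : (a, y) ∈ LinearMap.ker p) : g (s a) = x * g ⟨(a, y), hay⟩ := by
    rw [← smul_eq_mul, ← map_smul]
    congr 1
    refine Subtype.ext (Prod.ext rfl ?_)
    change -θ (φ a) = x • y
    rw [hmem hay, hθj, smul_neg, neg_neg]
  obtain ⟨χ, hχ⟩ := h.exists_factor (q ∘ₗ φ) (hs.surj.comp hφ) (Algebra.linearMap Q S ∘ₗ g ∘ₗ s)
    fun a ha ↦ by
      obtain ⟨y, hy⟩ := (hs.exact _).1 ha
      have hay : (a, -y) ∈ LinearMap.ker p := by simp [p, ← hy]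
      simp only [LinearMap.comp_apply, key a (-y) hay]
      exact h.map_mul_eq_zero _
  obtain ⟨v, hv⟩ := H χ
  obtain ⟨w, hw⟩ := h.exists_div (g ∘ₗ s - v ∘ₗ θ ∘ₗ φ) fun a ↦ by
    have := hχ a
    simp only [LinearMap.comp_apply, hv, Algebra.linearMap_apply] at this
    simp [this]
  refine ⟨w.coprod (-v), LinearMap.ext fun ⟨⟨a, y⟩, hay⟩ ↦ h.cancel ?_⟩
  have := hw a
  simp only [LinearMap.sub_apply, LinearMap.comp_apply, key a y hay, hmem hay, hθj, map_smul,
    map_neg, smul_eq_mul] at this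
  simp only [LinearMap.comp_apply, Submodule.subtype_apply, LinearMap.coprod_apply,
    LinearMap.neg_apply, mul_add, this]
  ring

end IsRegularQuotient

variable (Q S) in
/-- Reduction of a free `Q`-module. -/
def red (n : ℕ) : (Fin n → Q) →ₗ[Q] (Fin n → S) := (Algebra.linearMap Q S).compLeft (Fin n)

variable {M : Type u} [AddCommGroup M] [Module Q M] [Module S M] [IsScalarTower Q S M] {n : ℕ}

variable (Q) in
/-- The presentation over `Q` induced by one over `S`. -/
def lift (g : (Fin n → S) →ₗ[S] M) : (Fin n → Q) →ₗ[Q] M := g.restrictScalars Q ∘ₗ red Q S n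

namespace IsRegularQuotient

variable (h : IsRegularQuotient Q S x)

include h

lemma red_surjective : Function.Surjective (red Q S n) := fun z ↦ by
  choose y hy using fun i ↦ h.surjective (z i)
  exact ⟨y, funext hy⟩

lemma red_eq_zero_iff (y : Fin n → Q) : red Q S n y = 0 ↔ ∃ z, x • z = y := by
  constructor
  · intro hy
    choose z hz using fun i ↦ (h.eq_zero_iff (y i)).1 (congrFun hy i)
    exact ⟨z, funext fun i ↦ (hz i).symm⟩
  · rintro ⟨z, rfl⟩
    exact funext fun i ↦ h.map_mul_eq_zero (z i)

lemma smul_cancel {y z : Fin n → Q} (hyz : x • y = x • z) : y = z :=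
  funext fun i ↦ h.cancel (congrFun hyz i)

lemma ses_lift {g : (Fin n → S) →ₗ[S] M} (hg : Function.Surjective g) :
    SES (LinearMap.ker (lift Q g)).subtype (lift Q g) :=
  SES.ker (hg.comp h.red_surjective)

/-- The syzygy over `Q` is an extension of the syzygy over `S` by a free module. -/
lemma exists_ses_ker (g : (Fin n → S) →ₗ[S] M) :
    ∃ (j : (Fin n → Q) →ₗ[Q] LinearMap.ker (lift Q g))
      (q : LinearMap.ker (lift Q g) →ₗ[Q] LinearMap.ker g), SES j q ∧
        (∀ y, (j y : Fin n → Q) = x • y) ∧ ∀ k, (q k : Fin n → S) = red Q S n k := by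
  let j : (Fin n → Q) →ₗ[Q] LinearMap.ker (lift Q g) :=
    (x • LinearMap.id).codRestrict _ fun y ↦ by
      have : red Q S n (x • y) = 0 := (h.red_eq_zero_iff _).2 ⟨y, rfl⟩
      rw [LinearMap.mem_ker, LinearMap.smul_apply, LinearMap.id_apply, lift, LinearMap.comp_apply,
        this, map_zero]
  let q : LinearMap.ker (lift Q g) →ₗ[Q] LinearMap.ker g :=
    { toFun := fun k ↦ ⟨red Q S n k, k.2⟩
      map_add' := fun a b ↦ Subtype.ext (map_add (red Q S n) a.1 b.1)
      map_smul' := fun c a ↦ Subtype.ext (map_smul (red Q S n) c a.1) }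
  refine ⟨j, q, ⟨fun a b hab ↦ h.smul_cancel (congrArg Subtype.val hab), fun k ↦ ?_, fun m ↦ ?_⟩,
    fun _ ↦ rfl, fun _ ↦ rfl⟩
  · have : q k = 0 ↔ red Q S n k = 0 := Subtype.ext_iff
    rw [this, h.red_eq_zero_iff]
    exact exists_congr fun z ↦ ⟨fun hz ↦ Subtype.ext hz, congrArg Subtype.val⟩
  · obtain ⟨y, hy⟩ := h.red_surjective (m : Fin n → S)
    exact ⟨⟨y, by rw [LinearMap.mem_ker, ← m.2, ← hy]; rfl⟩, Subtype.ext hy⟩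

end IsRegularQuotient

end ChangeOfRings

section ChangeOfRingsExt

variable {Q S : Type u} [CommRing Q] [CommRing S] [Algebra Q S] {x : Q}

namespace IsRegularQuotient

variable (h : IsRegularQuotient Q S x)

include h

variable {M : Type u} [AddCommGroup M] [Module Q M] [Module S M] [IsScalarTower Q S M] {n : ℕ}

lemma extVan_of_extVan_base [IsNoetherianRing S] [Module.Finite S M]
    (H : ∀ i, ExtVan Q M (i + 2)) (i : ℕ) : ExtVan S M (i + 1) := by
  induction i generalizing M with
  | zero =>
    obtain ⟨n, g, hg⟩ := exists_ses_pi S M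
    have hl := h.ses_lift hg.surj
    obtain ⟨j, q, hjq, hj, hq⟩ := h.exists_ses_ker g
    refine hg.extVan_one (.of_projective 0) fun φ ↦ ?_
    obtain ⟨ψ, hψ⟩ := h.exists_lift (hl.extVan_left (.of_projective 0) (H 0))
      (φ.restrictScalars Q ∘ₗ q)
    simp only [LinearMap.comp_apply, LinearMap.restrictScalars_apply] at hψ
    obtain ⟨u, hu⟩ := h.exists_div (ψ ∘ₗ j) fun y ↦ by
      rw [LinearMap.comp_apply, hψ, hjq.exact.apply_apply_eq_zero, map_zero]
    obtain ⟨χ, hχ⟩ := h.exists_factor (red Q S n) h.red_surjective (Algebra.linearMap Q S ∘ₗ u)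
      fun y hy ↦ by
        obtain ⟨z, rfl⟩ := (h.red_eq_zero_iff y).1 hy
        rw [LinearMap.comp_apply, map_smul]
        exact h.map_mul_eq_zero (u z)
    refine ⟨χ, LinearMap.ext fun m ↦ ?_⟩
    obtain ⟨k, rfl⟩ := hjq.surj m
    have hk : u k = ψ k := h.cancel (by
      have : j k = x • k := Subtype.ext (hj k)
      rw [hu, LinearMap.comp_apply, this, map_smul, smul_eq_mul])
    rw [← hψ, ← hk]
    simp only [LinearMap.comp_apply, Submodule.subtype_apply, hq, hχ, Algebra.linearMap_apply]
  | succ i ih =>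
    obtain ⟨n, g, hg⟩ := exists_ses_pi S M
    have hl := h.ses_lift hg.surj
    obtain ⟨j, q, hjq, -⟩ := h.exists_ses_ker g
    have := hg.finite_left
    exact hg.extVan_right (ih fun i ↦ hjq.extVan_right (.of_projective i)
      (hl.extVan_left (.of_projective (i + 1)) (H (i + 1)))) (.of_projective (i + 1))

lemma extVan_base_of_extVan [IsNoetherianRing S] [Module.Finite S M]
    (H : ∀ i, ExtVan S M (i + 1)) (i : ℕ) : ExtVan Q M (i + 2) := by
  induction i generalizing M with
  | zero =>
    obtain ⟨n, g, hg⟩ := exists_ses_pi S M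
    have hl := h.ses_lift hg.surj
    obtain ⟨j, q, hjq, hj, hq⟩ := h.exists_ses_ker g
    refine hl.extVan_right (h.extVan_one hjq (LinearMap.ker (lift Q g)).subtype
      (fun k ↦ Subtype.ext (hj k)) hj fun φ ↦ ?_) (.of_projective 1)
    obtain ⟨χ, rfl⟩ := hg.exists_extend (H 0) φ
    obtain ⟨v, hv⟩ := h.exists_lift (.of_projective 0) (χ.restrictScalars Q ∘ₗ red Q S n)
    refine ⟨v, fun k ↦ ?_⟩
    rw [Submodule.subtype_apply, hv]
    simp only [LinearMap.comp_apply, Submodule.subtype_apply, hq, LinearMap.restrictScalars_apply]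
  | succ i ih =>
    obtain ⟨n, g, hg⟩ := exists_ses_pi S M
    have hl := h.ses_lift hg.surj
    obtain ⟨j, q, hjq, -⟩ := h.exists_ses_ker g
    have := hg.finite_left
    exact hl.extVan_right (hjq.extVan_mid (.of_projective (i + 1))
      (ih fun i ↦ hg.extVan_left (.of_projective i) (H (i + 1)))) (.of_projective (i + 2))

/-- The `Q`-dual of a syzygy over `Q` is an extension of the `S`-dual by a free module. -/
lemma exists_ses_dual {g : (Fin n → S) →ₗ[S] M} (hg : Function.Surjective g)
    {j : (Fin n → Q) →ₗ[Q] LinearMap.ker (lift Q g)} (hj : ∀ y, (j y : Fin n → Q) = x • y) :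
    ∃ q : Module.Dual Q (LinearMap.ker (lift Q g)) →ₗ[Q] Module.Dual S M,
      SES (LinearMap.ker (lift Q g)).subtype.dualMap q ∧
        ∀ κ y, q κ (lift Q g y) = algebraMap Q S (κ (j y)) := by
  have hl := h.ses_lift hg
  have hjk (k : LinearMap.ker (lift Q g)) : j k = x • k := Subtype.ext (hj k)
  have hlx (y) : lift Q g (x • y) = 0 := by rw [← hj]; exact (j y).2
  let J : Module.Dual S M →ₗ[Q] ((Fin n → Q) →ₗ[Q] S) :=
    { toFun := fun χ ↦ χ.restrictScalars Q ∘ₗ lift Q g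
      map_add' := fun _ _ ↦ rfl
      map_smul' := fun _ _ ↦ rfl }
  let I : Module.Dual Q (LinearMap.ker (lift Q g)) →ₗ[Q] ((Fin n → Q) →ₗ[Q] S) :=
    { toFun := fun κ ↦ Algebra.linearMap Q S ∘ₗ κ ∘ₗ j
      map_add' := fun a b ↦ LinearMap.ext fun y ↦ map_add (algebraMap Q S) _ _
      map_smul' := fun c a ↦ LinearMap.ext fun y ↦ by simp [Algebra.smul_def] }
  have hJ : Function.Injective J := fun a b hab ↦ LinearMap.ext fun m ↦ by
    obtain ⟨y, rfl⟩ := hl.surj m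
    exact LinearMap.congr_fun hab y
  obtain ⟨q, hq⟩ := exists_factor_injective J hJ I fun κ ↦ by
    obtain ⟨χ, hχ⟩ := h.exists_factor (lift Q g) hl.surj (I κ) fun y hy ↦ by
      change algebraMap Q S (κ (j (⟨y, hy⟩ : LinearMap.ker (lift Q g)))) = 0
      rw [hjk, map_smul]
      exact h.map_mul_eq_zero _
    exact ⟨χ, LinearMap.ext hχ⟩
  replace hq (κ y) : q κ (lift Q g y) = algebraMap Q S (κ (j y)) := LinearMap.congr_fun (hq κ) y
  refine ⟨q, ⟨(injective_iff_map_eq_zero _).2 fun φ hφ ↦ ?_, fun κ ↦ ?_, fun χ ↦ ?_⟩, hq⟩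
  · refine LinearMap.ext fun y ↦ h.cancel ?_
    have := LinearMap.congr_fun hφ (j y)
    rw [LinearMap.dualMap_apply, Submodule.subtype_apply, hj, map_smul] at this
    rw [LinearMap.zero_apply, mul_zero]
    exact this
  · constructor
    · intro hκ
      obtain ⟨φ, hφ⟩ := h.exists_div (κ ∘ₗ j) fun y ↦ by
        rw [LinearMap.comp_apply, ← hq, hκ, LinearMap.zero_apply]
      refine ⟨φ, LinearMap.ext fun k ↦ h.cancel ?_⟩
      rw [LinearMap.dualMap_apply, Submodule.subtype_apply, hφ, LinearMap.comp_apply, hjk,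
        map_smul, smul_eq_mul]
    · rintro ⟨φ, rfl⟩
      refine LinearMap.ext fun m ↦ ?_
      obtain ⟨y, rfl⟩ := hl.surj m
      rw [hq, LinearMap.dualMap_apply, Submodule.subtype_apply, hj, map_smul]
      exact h.map_mul_eq_zero _
  · obtain ⟨v, hv⟩ := h.exists_lift (.of_projective 0) (χ.restrictScalars Q ∘ₗ lift Q g)
    simp only [LinearMap.comp_apply, LinearMap.restrictScalars_apply] at hv
    obtain ⟨κ, hκ⟩ := h.exists_div (v ∘ₗ (LinearMap.ker (lift Q g)).subtype) fun k ↦ by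
      rw [LinearMap.comp_apply, hv, Submodule.subtype_apply, k.2, map_zero]
    refine ⟨κ, LinearMap.ext fun m ↦ ?_⟩
    obtain ⟨y, rfl⟩ := hl.surj m
    rw [hq, ← hv]
    congr 1
    apply h.cancel
    rw [hκ, LinearMap.comp_apply, Submodule.subtype_apply, hj, map_smul, smul_eq_mul]

lemma isTR_of_isTR_ker [IsNoetherianRing S] [Module.Finite S M] {g : (Fin n → S) →ₗ[S] M}
    (hg : Function.Surjective g) (hK : IsTR Q (LinearMap.ker (lift Q g))) : IsTR S M := by
  have hl := h.ses_lift hg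
  obtain ⟨j, -, -, hj, -⟩ := h.exists_ses_ker g
  obtain ⟨q, hs, hq⟩ := h.exists_ses_dual hg hj
  refine ⟨bijective_eval (fun m hm ↦ ?_) fun Ψ ↦ ?_, ?_, ?_⟩
  · obtain ⟨y, rfl⟩ := hl.surj m
    obtain ⟨ψ, hψ⟩ := h.exists_div (Module.Dual.eval Q _ (j y)) fun κ ↦ by
      rw [Module.Dual.eval_apply, ← hq, hm]
    obtain ⟨k, hk⟩ := hK.exists_eval ψ
    have : j y = x • k := sub_eq_zero.1 <| hK.eq_zero fun κ ↦ by
      rw [map_sub, map_smul, ← hk, smul_eq_mul, hψ, Module.Dual.eval_apply, sub_self]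
    have : y = k := h.smul_cancel (by rw [← hj, this]; rfl)
    rw [this]
    exact k.2
  · obtain ⟨ψ, hψ⟩ := h.exists_lift (hK.dual 0) (Ψ.restrictScalars Q ∘ₗ q)
    obtain ⟨k, hk⟩ := hK.exists_eval ψ
    have hred : red Q S n k = 0 := funext fun i ↦ by
      have := hψ ((LinearMap.ker (lift Q g)).subtype.dualMap (LinearMap.proj i))
      rw [hk, LinearMap.comp_apply, hs.exact.apply_apply_eq_zero, map_zero] at this
      exact this
    obtain ⟨y, hy⟩ := (h.red_eq_zero_iff _).1 hred
    refine ⟨lift Q g y, fun χ ↦ ?_⟩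
    obtain ⟨κ, rfl⟩ := hs.surj χ
    have : j y = k := Subtype.ext (by rw [hj, hy])
    rw [hq, this, ← hk, hψ]
    rfl
  · exact h.extVan_of_extVan_base fun i ↦
      hl.extVan_right (hK.van i) (.of_projective (i + 1))
  · exact h.extVan_of_extVan_base fun i ↦
      hs.extVan_right (.of_projective i) (hK.dual (i + 1))

lemma isTR_ker_of_isTR [IsNoetherianRing S] [Module.Finite S M] {g : (Fin n → S) →ₗ[S] M}
    (hg : Function.Surjective g) (hM : IsTR S M) : IsTR Q (LinearMap.ker (lift Q g)) := by
  have hl := h.ses_lift hg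
  obtain ⟨j, -, -, hj, -⟩ := h.exists_ses_ker g
  have hjk (k : LinearMap.ker (lift Q g)) : j k = x • k := Subtype.ext (hj k)
  obtain ⟨q, hs, hq⟩ := h.exists_ses_dual hg hj
  have hF : IsTR Q (Fin n → Q) := .of_projective
  have hιj (κ : Module.Dual Q (LinearMap.ker (lift Q g))) :
      (LinearMap.ker (lift Q g)).subtype.dualMap (j.dualMap κ) = x • κ :=
    LinearMap.ext fun k ↦ by
      rw [LinearMap.dualMap_apply, Submodule.subtype_apply, LinearMap.dualMap_apply, hjk, map_smul]
      rfl
  refine ⟨bijective_eval (fun k hk ↦ Subtype.ext <| funext fun i ↦ ?_) fun ψ ↦ ?_, fun i ↦ ?_,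
    fun i ↦ ?_⟩
  · exact hk (LinearMap.proj i ∘ₗ (LinearMap.ker (lift Q g)).subtype)
  · obtain ⟨y, hy⟩ := hF.exists_eval (ψ ∘ₗ (LinearMap.ker (lift Q g)).subtype.dualMap)
    have hψ (κ) : x * ψ κ = κ (j y) := by
      rw [← smul_eq_mul, ← map_smul, ← hιj]
      exact hy _
    have hmem : lift Q g y = 0 := hM.eq_zero fun χ ↦ by
      obtain ⟨κ, rfl⟩ := hs.surj χ
      rw [hq, ← hψ]
      exact h.map_mul_eq_zero _
    refine ⟨⟨y, hmem⟩, fun κ ↦ h.cancel ?_⟩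
    rw [hψ, ← smul_eq_mul, ← map_smul, ← hjk]
  · exact hl.extVan_left (.of_projective i) (h.extVan_base_of_extVan hM.van i)
  · cases i with
    | zero =>
      refine h.extVan_one hs j.dualMap hιj (fun φ ↦ LinearMap.ext fun y ↦ ?_) fun Ψ ↦ ?_
      · rw [LinearMap.dualMap_apply, LinearMap.dualMap_apply, Submodule.subtype_apply, hj, map_smul]
        rfl
      · obtain ⟨m, hm⟩ := hM.exists_eval Ψ
        obtain ⟨y, rfl⟩ := hl.surj m
        exact ⟨Module.Dual.eval Q _ y, fun κ ↦ by rw [hm, hq]; rfl⟩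
    | succ i => exact hs.extVan_mid (.of_projective (i + 1)) (h.extVan_base_of_extVan hM.dual i)

/-- Killing a regular element lowers the G-dimension by one. -/
lemma gProjLE_succ_iff [IsNoetherianRing Q] [IsNoetherianRing S] [Module.Finite S M] (d : ℕ) :
    GProjLE Q (d + 1) M ↔ GProjLE S d M := by
  induction d generalizing M with
  | zero =>
    obtain ⟨n, g, hg⟩ := exists_ses_pi S M
    exact (h.ses_lift hg.surj).gProjLE_iff.trans
      ⟨h.isTR_of_isTR_ker hg.surj, h.isTR_ker_of_isTR hg.surj⟩
  | succ d ih =>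
    obtain ⟨n, g, hg⟩ := exists_ses_pi S M
    have hl := h.ses_lift hg.surj
    obtain ⟨j, q, hjq, -⟩ := h.exists_ses_ker g
    have := hl.finite_left
    have := hjq.finite_right
    have := hg.finite_left
    rw [hl.gProjLE_iff, hjq.gProjLE_succ_iff_of_projective_left, ih, hg.gProjLE_iff]

end IsRegularQuotient

end ChangeOfRingsExt

section Dimension

variable {A : Type u} [CommRing A]

lemma sInf_eq_coe {p : ℕ → Prop} {m : ℕ} (hm : p m) (hmin : ∀ k < m, ¬ p k) :
    sInf {d : ℕ∞ | ∃ n : ℕ, d = n ∧ p n} = m := by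
  refine le_antisymm (sInf_le ⟨m, rfl, hm⟩) (le_sInf ?_)
  rintro _ ⟨k, rfl, hk⟩
  exact_mod_cast not_lt.1 fun hkm ↦ hmin k hkm hk

lemma GProjLE.succ [IsNoetherianRing A] {M : Type u} [AddCommGroup M] [Module A M]
    [Module.Finite A M] {n : ℕ} (h : GProjLE A n M) : GProjLE A (n + 1) M := by
  induction n generalizing M with
  | zero =>
    obtain ⟨m, p, hp⟩ := exists_ses_pi A M
    exact hp.gProjLE_succ (n := 0) (hp.isTR_left h)
  | succ n ih =>
    obtain ⟨m, p, hp⟩ := exists_ses_pi A M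
    have := hp.finite_left
    exact hp.gProjLE_succ (ih (hp.gProjLE_left h))

lemma exists_gProjLE_of_gdim_ne_top [IsNoetherianRing A] (M : ModuleCat.{u} A)
    [Module.Finite A M] (h : Gdim A M ≠ ⊤) : ∃ n, GProjLE A n M := by
  by_contra! H
  refine h (sInf_eq_top.2 ?_)
  rintro _ ⟨n, rfl, hn⟩
  exact (H n ((gdimLE_iff n M).1 hn)).elim

end Dimension

/-- The approximation underlying the lift of a projective hull. -/
lemma IsRegularQuotient.exists_hull {Q S : Type u} [CommRing Q] [CommRing S] [Algebra Q S] {x : Q}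
    (h : IsRegularQuotient Q S x) [IsNoetherianRing Q] [IsNoetherianRing S]
    (M : ModuleCat.{u} S) [Module.Finite S M] [Module Q M] [IsScalarTower Q S M]
    (hM : Gdim Q (.of Q M) ≠ ⊤) :
    ∃ (X G : Type u) (_ : AddCommGroup X) (_ : AddCommGroup G) (_ : Module Q X) (_ : Module Q G)
      (a : X →ₗ[Q] G) (b : G →ₗ[Q] M), TotallyReflexive Q (.of Q G) ∧
        projDim Q (.of Q X) = Gdim S M ∧ SES a b := by
  have : Module.Finite Q S := .of_surjective (Algebra.linearMap Q S) h.surjective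
  have : Module.Finite Q M := .trans S M
  obtain ⟨n, hn⟩ := exists_gProjLE_of_gdim_ne_top (ModuleCat.of Q M) hM
  have hex : ∃ m, GProjLE S m M := ⟨n, (h.gProjLE_succ_iff n).1 (GProjLE.succ (M := M) hn)⟩
  classical
  obtain ⟨m, hm, hmin⟩ : ∃ m, GProjLE S m M ∧ ∀ k < m, ¬ GProjLE S k M :=
    ⟨Nat.find hex, Nat.find_spec hex, fun _ ↦ Nat.find_min hex⟩
  obtain ⟨X, G, _, _, _, _, a, b, _, hG, hab, hX⟩ :=
    ((h.gProjLE_succ_iff m).2 hm).exists_approximation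
  have := hab.finite_left
  refine ⟨X, G, _, _, _, _, a, b, (totallyReflexive_iff _).2 hG, ?_, hab⟩
  rw [projDim, Gdim, sInf_eq_coe ((projDimLE_iff m (.of Q X)).2 hX),
    sInf_eq_coe ((gdimLE_iff m M).2 hm)]
  · exact fun k hk hkM ↦ hmin k hk ((gdimLE_iff k M).1 hkM)
  · exact fun k hk hkX ↦ hmin k hk ((h.gProjLE_succ_iff k).1 (hab.gProjLE_succ_of_isTR hG
      (.of_hasProjectiveDimensionLT k X ((projDimLE_iff k (.of Q X)).1 hkX))))

lemma isRegularQuotient_quotient {Q : Type u} [CommRing Q] {x : Q} (hx : x ∈ nonZeroDivisors Q) :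
    IsRegularQuotient Q (Q ⧸ Ideal.span {x}) x where
  regular := hx
  surjective := Ideal.Quotient.mk_surjective
  eq_zero_iff a := by
    rw [Ideal.Quotient.algebraMap_eq, Ideal.Quotient.eq_zero_iff_mem, Ideal.mem_span_singleton]

end HullLift

theorem stmt7 (Q : Type u) [CommRing Q] [IsLocalRing Q] [IsNoetherianRing Q]
    (x : Q) (hx : x ∈ IsLocalRing.maximalIdeal Q) (hreg : x ∈ nonZeroDivisors Q)
    (M : ModuleCat.{u} (Q ⧸ Ideal.span {x}))
    (hfg : Module.Finite (Q ⧸ Ideal.span {x}) M)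
    (hGQ : Gdim Q ((ModuleCat.restrictScalars (Ideal.Quotient.mk (Ideal.span {x}))).obj M) ≠ ⊤)
    (X G : ModuleCat.{u} (Q ⧸ Ideal.span {x}))
    (i : M ⟶ X) (p : X ⟶ G) (w : i ≫ p = 0)
    (hse : (ShortComplex.mk i p w).ShortExact)
    (hG : TotallyReflexive (Q ⧸ Ideal.span {x}) G)
    (hX : projDim (Q ⧸ Ideal.span {x}) X = Gdim (Q ⧸ Ideal.span {x}) M) :
    ∃ (X' G' : ModuleCat.{u} Q) (a : X' ⟶ G')
      (b : G' ⟶ (ModuleCat.restrictScalars (Ideal.Quotient.mk (Ideal.span {x}))).obj M)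
      (w' : a ≫ b = 0),
      TotallyReflexive Q G' ∧ projDim Q X' = Gdim (Q ⧸ Ideal.span {x}) M ∧
      (ShortComplex.mk a b w').ShortExact := by
  let _ : Module Q M := .compHom M (Ideal.Quotient.mk (Ideal.span {x}))
  have : IsScalarTower Q (Q ⧸ Ideal.span {x}) M := .of_algebraMap_smul fun _ _ ↦ rfl
  obtain ⟨X', G', _, _, _, _, a, b, hG', hX', hab⟩ :=
    (HullLift.isRegularQuotient_quotient hreg).exists_hull M hGQ
  exact ⟨.of Q X', .of Q G', ModuleCat.ofHom a, ModuleCat.ofHom b, _, hG', hX', hab.shortExact⟩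

end
end
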